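/- Let s > −1/6, b > 1/2, and let b′ satisfy −1/2 < b′ < s − 1/3 if −1/6 < s ≤ 0, and −1/2 < b′ < −1/3 if s ≥ 0. Then there exists a constant C, depending only on s, b, b′ (and in particular independent of σ), such that for all σ ≥ 0 and all (say, Schwartz) functions u₁, u₂, u₃, u₄ : ℝ² → ℂ one has ‖∂_x(u₁u₂u₃u₄)‖_{X^{σ,s,b′}} ≤ C ∏_{j=1}^{4} ‖u_j‖_{X^{σ,s,b}}. -/

import Mathlib

open MeasureTheory Set
open scoped ENNReal

noncomputable section

/-- The Fourier transform `f̂(ξ) = ∫ e^{-ixξ} f(x) dx`. -/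
def FT (f : ℝ → ℂ) (ξ : ℝ) : ℂ :=
  ∫ x : ℝ, Complex.exp (-Complex.I * x * ξ) * f x

/-- The Japanese bracket power `⟨ξ⟩^s = (1 + ξ²)^(s/2)`. -/
def jap (s ξ : ℝ) : ℝ := (1 + ξ ^ 2) ^ (s / 2)

/-- The Gevrey norm `‖f‖_{G^{σ,s}} = ‖e^{σ|ξ|} ⟨ξ⟩^s f̂(ξ)‖_{L²_ξ(ℝ)}`, valued in `ℝ≥0∞`.
`f ∈ G^{σ,s}(ℝ)` means `gevreyNorm σ s f < ⊤`. -/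
def gevreyNorm (σ s : ℝ) (f : ℝ → ℂ) : ℝ≥0∞ :=
  eLpNorm (fun ξ : ℝ => ((Real.exp (σ * |ξ|) * jap s ξ : ℝ) : ℂ) * FT f ξ) 2 volume

/-- The space-time Fourier transform `ũ(τ,ξ) = ∫_{ℝ²} e^{i(tτ+xξ)} u(t,x) dt dx`
(for `u` written in curried form, first variable `t`, second `x`). -/
def FT2 (u : ℝ → ℝ → ℂ) (τ ξ : ℝ) : ℂ :=
  ∫ p : ℝ × ℝ, Complex.exp (Complex.I * (p.1 * τ + p.2 * ξ)) * u p.1 p.2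

/-- The Gevrey–Bourgain norm
`‖u‖_{X^{σ,s,b}} = ‖e^{σ|D_x|}u‖_{X^{s,b}} = ‖e^{σ|ξ|} ⟨ξ⟩^s ⟨τ-ξ³⟩^b ũ(τ,ξ)‖_{L²_{τ,ξ}}`.
Taking `σ = 0` gives the Bourgain norm `‖u‖_{X^{s,b}}`. -/
def XNorm (σ s b : ℝ) (u : ℝ → ℝ → ℂ) : ℝ≥0∞ :=
  eLpNorm (fun p : ℝ × ℝ =>
    ((Real.exp (σ * |p.2|) * jap s p.2 * jap b (p.1 - p.2 ^ 3) : ℝ) : ℂ) * FT2 u p.1 p.2)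
    2 volume

/-- The restriction norm `‖u‖_{X^{σ,s,b}_δ} = inf {‖v‖_{X^{σ,s,b}} : v = u on ℝ × (0,δ)}`. -/
def XRestNorm (σ s b δ : ℝ) (u : ℝ → ℝ → ℂ) : ℝ≥0∞ :=
  sInf {r : ℝ≥0∞ | ∃ v : ℝ → ℝ → ℂ, (∀ t ∈ Set.Ioo 0 δ, v t = u t) ∧ XNorm σ s b v = r}

/-- `u : ℝ → ℝ → E` (curried) is a Schwartz function of the pair of variables. -/
def IsSchwartz {E : Type*} [NormedAddCommGroup E] [NormedSpace ℝ E] (u : ℝ → ℝ → E) : Prop :=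
  ∃ φ : SchwartzMap (ℝ × ℝ) E, ∀ t x, u t x = φ (t, x)

/-- Change of variables as an inequality, for an injective function on a measurable set. -/
theorem setLIntegral_abs_deriv_mul_comp_le {f f' : ℝ → ℝ} {S : Set ℝ} (hS : MeasurableSet S)
    (hf : ∀ x ∈ S, HasDerivAt f (f' x) x) (hinj : InjOn f S) (F : ℝ → ℝ≥0∞) :
    ∫⁻ x in S, ENNReal.ofReal |f' x| * F (f x) ≤ ∫⁻ y, F y := by
  rw [← lintegral_image_eq_lintegral_abs_deriv_mul hS
    (fun x hx => (hf x hx).hasDerivWithinAt) hinj]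
  exact setLIntegral_le_lintegral _ _

/-- A quadratic polynomial is at most two-to-one. -/
theorem lintegral_abs_deriv_mul_comp_quadratic_le (a b c : ℝ) {F : ℝ → ℝ≥0∞} (hF : Measurable F) :
    ∫⁻ x, ENNReal.ofReal |2 * a * x + b| * F (a * x ^ 2 + b * x + c) ≤ 2 * ∫⁻ y, F y := by
  have hd : ∀ x : ℝ, HasDerivAt (fun x => a * x ^ 2 + b * x + c) (2 * a * x + b) x := by
    intro x
    have := (((hasDerivAt_pow 2 x).const_mul a).add ((hasDerivAt_id x).const_mul b)).add_const c
    refine this.congr_deriv ?_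
    simp; ring
  have hm1 : MeasurableSet {x : ℝ | 0 < 2 * a * x + b} :=
    measurableSet_lt measurable_const (by fun_prop)
  have hm2 : MeasurableSet {x : ℝ | 2 * a * x + b < 0} :=
    measurableSet_lt (by fun_prop) measurable_const
  have key : ∀ x y : ℝ, (a * x ^ 2 + b * x + c) - (a * y ^ 2 + b * y + c)
      = (x - y) * ((2 * a * x + b) + (2 * a * y + b)) / 2 := by intros; ring
  have h1 := setLIntegral_abs_deriv_mul_comp_le hm1 (fun x _ => hd x) (by
    intro x hx y hy hxy
    have := key x y
    simp only [mem_ofPred_eq] at hx hy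
    have h0 : (x - y) * ((2 * a * x + b) + (2 * a * y + b)) = 0 := by
      simp only at hxy; linarith
    rcases mul_eq_zero.1 h0 with h | h <;> linarith) F
  have h2 := setLIntegral_abs_deriv_mul_comp_le hm2 (fun x _ => hd x) (by
    intro x hx y hy hxy
    have := key x y
    simp only [mem_ofPred_eq] at hx hy
    have h0 : (x - y) * ((2 * a * x + b) + (2 * a * y + b)) = 0 := by
      simp only at hxy; linarith
    rcases mul_eq_zero.1 h0 with h | h <;> linarith) F
  have hmeas : Measurable fun x : ℝ =>
      ENNReal.ofReal |2 * a * x + b| * F (a * x ^ 2 + b * x + c) := by fun_prop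
  refine le_trans ?_ ((add_le_add h1 h2).trans_eq (two_mul _).symm)
  rw [← lintegral_indicator hm1, ← lintegral_indicator hm2,
    ← lintegral_add_left (hmeas.indicator hm1)]
  refine lintegral_mono fun x => ?_
  rcases lt_trichotomy (2 * a * x + b) 0 with h | h | h
  · rw [indicator_of_mem (s := {x : ℝ | 2 * a * x + b < 0}) h]
    exact le_add_self
  · simp [h]
  · rw [indicator_of_mem (s := {x : ℝ | 0 < 2 * a * x + b}) h]
    exact le_self_add

/-- Translation–reflection of the inner variable. -/
theorem lintegral_lintegral_sub_swap {G : ℝ → ℝ → ℝ≥0∞} (hG : Measurable (Function.uncurry G)) :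
    ∫⁻ x, ∫⁻ y, G x y = ∫⁻ m, ∫⁻ x, G x (m - x) := by
  have h1 : ∀ x : ℝ, ∫⁻ y, G x y = ∫⁻ m, G x (m - x) := fun x =>
    (lintegral_sub_right_eq_self (fun y => G x y) x).symm
  simp_rw [h1]
  refine lintegral_lintegral_swap (f := fun x m => G x (m - x)) ?_
  have : Measurable fun p : ℝ × ℝ => (p.1, p.2 - p.1) := by fun_prop
  exact (hG.comp this).aemeasurable

/-- The bilinear Airy estimate on the level of the phase function. -/
theorem lintegral_bilinear_le (c d : ℝ) {F : ℝ × ℝ → ℝ≥0∞} (hF : Measurable F) :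
    ∫⁻ x, ∫⁻ y, ENNReal.ofReal |x ^ 2 - y ^ 2| * F (c + x ^ 3 + y ^ 3, d + x + y)
      ≤ ∫⁻ p, F p := by
  rw [lintegral_lintegral_sub_swap (G := fun x y =>
    ENNReal.ofReal |x ^ 2 - y ^ 2| * F (c + x ^ 3 + y ^ 3, d + x + y))
    (by simp only [Function.uncurry_def]; fun_prop)]
  have hin : ∀ m : ℝ, ∫⁻ x, ENNReal.ofReal |x ^ 2 - (m - x) ^ 2| *
      F (c + x ^ 3 + (m - x) ^ 3, d + x + (m - x)) ≤ ∫⁻ τ, F (τ, d + m) := by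
    intro m
    have h := lintegral_abs_deriv_mul_comp_quadratic_le (3 * m) (-3 * m ^ 2) (c + m ^ 3)
      (F := fun τ => F (τ, d + m)) (by fun_prop)
    have h2 : ∫⁻ x, ENNReal.ofReal |2 * (3 * m) * x + -3 * m ^ 2| *
        F (3 * m * x ^ 2 + -3 * m ^ 2 * x + (c + m ^ 3), d + m) =
        3 * ∫⁻ x, ENNReal.ofReal |x ^ 2 - (m - x) ^ 2| *
          F (c + x ^ 3 + (m - x) ^ 3, d + x + (m - x)) := by
      rw [← lintegral_const_mul _ (by fun_prop)]
      refine lintegral_congr fun x => ?_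
      rw [← mul_assoc (3 : ℝ≥0∞)]
      congr 1
      · rw [show 2 * (3 * m) * x + -3 * m ^ 2 = 3 * (x ^ 2 - (m - x) ^ 2) by ring, abs_mul,
          ENNReal.ofReal_mul (abs_nonneg _)]
        norm_num
      · congr 2 <;> ring
    rw [h2] at h
    refine (ENNReal.mul_le_mul_iff_right (a := 3) (by norm_num) (by norm_num)).1 (h.trans ?_)
    gcongr
    norm_num
  refine (lintegral_mono hin).trans ?_
  rw [lintegral_add_left_eq_self (fun m => ∫⁻ τ, F (τ, m)) d, Measure.volume_eq_prod,
    lintegral_prod_symm _ hF.aemeasurable]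

/-- Auxiliary estimate: the restriction of a cubic to a half-line on which it is monotone. -/
theorem setLIntegral_cubic_half_le (m k c : ℝ) (hk : |k| ≤ 1) {S : Set ℝ} (hS : MeasurableSet S)
    (hSm : ∀ u ∈ S, |u| ≤ |m| / 9) (hsign : ∀ u ∈ S, ∀ w ∈ S, 0 < u * w) (F : ℝ → ℝ≥0∞) :
    ∫⁻ u in S, ENNReal.ofReal (|u| * |m|) *
      F (c + 2 * m * (u ^ 2 + u * (u * k) + (u * k) ^ 2) - 3 * u * (u * k) * (u + u * k))
      ≤ ∫⁻ τ, F τ := by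
  set f : ℝ → ℝ := fun u =>
    c + 2 * m * (u ^ 2 + u * (u * k) + (u * k) ^ 2) - 3 * u * (u * k) * (u + u * k) with hfdef
  set f' : ℝ → ℝ := fun u => u * (4 * m * (1 + k + k ^ 2) - 9 * (k * (1 + k)) * u) with hf'def
  have hk1 := abs_le.1 hk
  have hq : 3 / 4 ≤ 1 + k + k ^ 2 := by nlinarith [sq_nonneg (k + 1 / 2)]
  have hkk : |k * (1 + k)| ≤ 2 := by
    rw [abs_mul]
    have : |1 + k| ≤ 2 := by rw [abs_le]; constructor <;> linarith
    nlinarith [abs_nonneg k, abs_nonneg (1 + k)]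
  have hd : ∀ u, HasDerivAt f (f' u) u := by
    intro u
    have h := (((hasDerivAt_pow 2 u).const_mul (2 * m * (1 + k + k ^ 2))).sub
      ((hasDerivAt_pow 3 u).const_mul (3 * k * (1 + k)))).const_add c
    have he : f = fun u => c + (2 * m * (1 + k + k ^ 2) * u ^ 2 - 3 * k * (1 + k) * u ^ 3) := by
      funext u; simp only [hfdef]; ring
    rw [he]
    refine h.congr_deriv ?_
    simp only [hf'def]; push_cast; ring
  have hlow : ∀ u ∈ S, |u| * |m| ≤ |f' u| := by
    intro u hu
    simp only [hf'def, abs_mul]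
    refine mul_le_mul_of_nonneg_left ?_ (abs_nonneg _)
    have h1 : |4 * m * (1 + k + k ^ 2)| = 4 * |m| * (1 + k + k ^ 2) := by
      rw [abs_mul, abs_mul, abs_of_pos (by linarith : (0 : ℝ) < 1 + k + k ^ 2)]; norm_num
    have h2 : |9 * (k * (1 + k)) * u| ≤ 9 * 2 * (|m| / 9) := by
      rw [abs_mul, abs_mul]
      have : |(9 : ℝ)| = 9 := by norm_num
      rw [this]
      gcongr
      exact hSm u hu
    have h3 := abs_sub_abs_le_abs_sub (4 * m * (1 + k + k ^ 2)) (9 * (k * (1 + k)) * u)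
    rw [h1] at h3
    nlinarith [abs_nonneg m]
  have hinj : InjOn f S := by
    intro u hu w hw huw
    by_contra hne
    have hfac : f u - f w = (u - w) * (2 * m * (1 + k + k ^ 2) * (u + w) -
        3 * (k * (1 + k)) * (u ^ 2 + u * w + w ^ 2)) := by simp only [hfdef]; ring
    rw [huw, sub_self] at hfac
    rcases mul_eq_zero.1 hfac.symm with h | h
    · exact hne (by linarith)
    · have hs := hsign u hu w hw
      have hsum : |u + w| ≤ 2 * |m| / 9 := by
        have := abs_add_le u w; have := hSm u hu; have := hSm w hw; linarith
      have hsq : u ^ 2 + u * w + w ^ 2 ≤ |u + w| ^ 2 := by rw [sq_abs]; nlinarith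
      have hpos : 0 < |u + w| := by
        rw [abs_pos]; intro h0
        have : w = -u := by linarith
        subst this; nlinarith [sq_nonneg u]
      have e1 : |2 * m * (1 + k + k ^ 2) * (u + w)| = 2 * |m| * (1 + k + k ^ 2) * |u + w| := by
        rw [abs_mul, abs_mul, abs_mul, abs_of_pos (by linarith : (0 : ℝ) < 1 + k + k ^ 2)]
        norm_num
      have e2 : |3 * (k * (1 + k)) * (u ^ 2 + u * w + w ^ 2)| ≤ 3 * 2 * |u + w| ^ 2 := by
        rw [abs_mul, abs_mul, abs_of_nonneg (a := u ^ 2 + u * w + w ^ 2)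
          (by nlinarith [sq_nonneg u, sq_nonneg w])]
        have : |(3 : ℝ)| = 3 := by norm_num
        rw [this]
        gcongr
      have e3 : |2 * m * (1 + k + k ^ 2) * (u + w)| =
          |3 * (k * (1 + k)) * (u ^ 2 + u * w + w ^ 2)| := by
        rw [sub_eq_zero.1 h]
      have hm0 : 0 < |m| := by linarith
      have e4 : 2 * |m| * (1 + k + k ^ 2) ≤ 6 * |u + w| := by
        refine le_of_mul_le_mul_right ?_ hpos
        nlinarith
      nlinarith
  refine le_trans ?_ (setLIntegral_abs_deriv_mul_comp_le hS (fun u _ => hd u) hinj F)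
  refine setLIntegral_mono' hS fun u hu => ?_
  gcongr
  exact hlow u hu

theorem measurableSet_le_and_le {X : Type*} [MeasurableSpace X] {f g h k : X → ℝ}
    (hf : Measurable f) (hg : Measurable g) (hh : Measurable h) (hk : Measurable k) :
    MeasurableSet {x | f x ≤ g x ∧ h x ≤ k x} :=
  (measurableSet_le hf hg).inter (measurableSet_le hh hk)

/-- The sector `|v| ≤ |u|` of the cubic curve estimate. -/
theorem lintegral_cubic_sector_le (m c : ℝ) {F : ℝ → ℝ≥0∞} (hF : Measurable F) :
    ∫⁻ u, ∫⁻ v, {p : ℝ × ℝ | |p.1| ≤ |m| / 9 ∧ |p.2| ≤ |p.1|}.indicator (fun p =>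
      ENNReal.ofReal |m| * F (c + 2 * m * (p.1 ^ 2 + p.1 * p.2 + p.2 ^ 2)
        - 3 * p.1 * p.2 * (p.1 + p.2))) (u, v) ≤ 4 * ∫⁻ τ, F τ := by
  set E : Set (ℝ × ℝ) := {p : ℝ × ℝ | |p.1| ≤ |m| / 9 ∧ |p.2| ≤ |p.1|}
  have hE : MeasurableSet E :=
    measurableSet_le_and_le (by fun_prop) (by fun_prop) (by fun_prop) (by fun_prop)
  set G : ℝ × ℝ → ℝ≥0∞ := fun p => ENNReal.ofReal |m| *
    F (c + 2 * m * (p.1 ^ 2 + p.1 * p.2 + p.2 ^ 2) - 3 * p.1 * p.2 * (p.1 + p.2))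
  have hG : Measurable G := by fun_prop
  have hEG : Measurable (E.indicator G) := hG.indicator hE
  have hscale : ∀ u : ℝ, u ≠ 0 → ∫⁻ v, E.indicator G (u, v) =
      ∫⁻ k, ENNReal.ofReal |u| * E.indicator G (u, u * k) := by
    intro u hu
    have h := lintegral_image_eq_lintegral_abs_deriv_mul (s := univ) (f := fun k => u * k)
      (f' := fun _ => u) MeasurableSet.univ
      (fun x _ => by
        simpa using (((hasDerivAt_id x).const_mul u).hasDerivWithinAt (s := univ)))
      (fun x _ y _ hxy => mul_left_cancel₀ hu hxy) (fun v => E.indicator G (u, v))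
    rw [image_univ, (mul_left_surjective₀ hu).range_eq] at h
    simpa using h
  have hle : ∀ᵐ u : ℝ, ∫⁻ v, E.indicator G (u, v) ≤
      ∫⁻ k, ENNReal.ofReal |u| * E.indicator G (u, u * k) := by
    have h0 : ∀ᵐ u : ℝ, u ≠ 0 := by simp [ae_iff]
    filter_upwards [h0] with u hu using (hscale u hu).le
  refine (lintegral_mono_ae hle).trans ?_
  rw [lintegral_lintegral_swap (by fun_prop)]
  have hk : ∀ k : ℝ, ∫⁻ u, ENNReal.ofReal |u| * E.indicator G (u, u * k) ≤
      (Icc (-1 : ℝ) 1).indicator (fun _ => 2 * ∫⁻ τ, F τ) k := by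
    intro k
    by_cases hk : |k| ≤ 1
    · rw [indicator_of_mem (by exact abs_le.1 hk)]
      have hp := setLIntegral_cubic_half_le m k c hk (S := Ioc 0 (|m| / 9)) measurableSet_Ioc
        (fun u hu => by rw [abs_of_pos hu.1]; exact hu.2) (fun u hu w hw => mul_pos hu.1 hw.1) F
      have hn := setLIntegral_cubic_half_le m k c hk (S := Ico (-(|m| / 9)) 0) measurableSet_Ico
        (fun u hu => by rw [abs_of_neg hu.2]; linarith [hu.1])
        (fun u hu w hw => mul_pos_of_neg_of_neg hu.2 hw.2) F
      refine le_trans ?_ ((add_le_add hp hn).trans_eq (two_mul _).symm)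
      rw [← lintegral_indicator measurableSet_Ioc, ← lintegral_indicator measurableSet_Ico,
        ← lintegral_add_left (Measurable.indicator (by fun_prop) measurableSet_Ioc)]
      refine lintegral_mono fun u => ?_
      have hval : ENNReal.ofReal |u| * G (u, u * k) = ENNReal.ofReal (|u| * |m|) *
          F (c + 2 * m * (u ^ 2 + u * (u * k) + (u * k) ^ 2) - 3 * u * (u * k) * (u + u * k)) := by
        simp only [G]
        rw [ENNReal.ofReal_mul (abs_nonneg _), ← mul_assoc]
      by_cases hmem : (u, u * k) ∈ E
      · rw [indicator_of_mem hmem, hval]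
        have hu := abs_le.1 hmem.1
        rcases lt_trichotomy u 0 with h | h | h
        · rw [indicator_of_mem (s := Ico (-(|m| / 9)) 0) ⟨hu.1, h⟩]
          exact le_add_self
        · simp [h]
        · rw [indicator_of_mem (s := Ioc 0 (|m| / 9)) ⟨h, hu.2⟩]
          exact le_self_add
      · simp [indicator_of_notMem hmem]
    · refine le_of_eq_of_le ?_ (zero_le)
      refine lintegral_eq_zero_of_ae_eq_zero ?_
      have h0 : ∀ᵐ u : ℝ, u ≠ 0 := by simp [ae_iff]
      filter_upwards [h0] with u hu
      have : (u, u * k) ∉ E := by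
        rintro ⟨-, h⟩
        simp only [abs_mul] at h
        have := abs_pos.2 hu
        push Not at hk
        nlinarith
      simp [indicator_of_notMem this]
  refine (lintegral_mono hk).trans ?_
  rw [lintegral_indicator measurableSet_Icc, setLIntegral_const, Real.volume_Icc, mul_comm,
    ← mul_assoc]
  gcongr
  norm_num

theorem lintegral_cubic_disc_le (m c : ℝ) {F : ℝ → ℝ≥0∞} (hF : Measurable F) :
    ∫⁻ u, ∫⁻ v, {p : ℝ × ℝ | |p.1| ≤ |m| / 9 ∧ |p.2| ≤ |m| / 9}.indicator (fun p =>
      ENNReal.ofReal |m| * F (c + 2 * m * (p.1 ^ 2 + p.1 * p.2 + p.2 ^ 2)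
        - 3 * p.1 * p.2 * (p.1 + p.2))) (u, v) ≤ 8 * ∫⁻ τ, F τ := by
  set G : ℝ × ℝ → ℝ≥0∞ := fun p => ENNReal.ofReal |m| *
    F (c + 2 * m * (p.1 ^ 2 + p.1 * p.2 + p.2 ^ 2) - 3 * p.1 * p.2 * (p.1 + p.2))
  have hG : Measurable G := by fun_prop
  have h := lintegral_cubic_sector_le m c hF
  set E : Set (ℝ × ℝ) := {p : ℝ × ℝ | |p.1| ≤ |m| / 9 ∧ |p.2| ≤ |p.1|}
  have hE : MeasurableSet E :=
    measurableSet_le_and_le (by fun_prop) (by fun_prop) (by fun_prop) (by fun_prop)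
  have hEG : Measurable (E.indicator G) := hG.indicator hE
  have h' : ∫⁻ u, ∫⁻ v, E.indicator G (v, u) ≤ 4 * ∫⁻ τ, F τ := by
    rw [lintegral_lintegral_swap (by fun_prop)]
    exact h
  refine le_trans ?_ ((add_le_add h h').trans_eq (by rw [← add_mul]; norm_num))
  rw [← lintegral_add_left (by fun_prop)]
  refine lintegral_mono fun u => ?_
  rw [← lintegral_add_left (by fun_prop)]
  refine lintegral_mono fun v => ?_
  by_cases hmem : |u| ≤ |m| / 9 ∧ |v| ≤ |m| / 9
  · rw [indicator_of_mem (by exact hmem)]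
    rcases le_total |v| |u| with hvu | hvu
    · rw [indicator_of_mem (s := E) (a := (u, v)) ⟨hmem.1, hvu⟩]
      exact le_self_add
    · rw [indicator_of_mem (s := E) (a := (v, u)) ⟨hmem.2, hvu⟩]
      refine le_trans (le_of_eq ?_) le_add_self
      simp only [G]
      congr 2; ring
  · rw [indicator_of_notMem (by exact hmem)]; exact zero_le

/-- The trilinear estimate for three nearly equal frequencies. -/
theorem lintegral_trilinear_le (c d : ℝ) {F : ℝ × ℝ → ℝ≥0∞} (hF : Measurable F) :
    ∫⁻ x, ∫⁻ y, ∫⁻ z,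
      {m : ℝ | |x - m / 3| ≤ |m| / 9 ∧ |y - m / 3| ≤ |m| / 9}.indicator
        (fun m => ENNReal.ofReal |m| * F (c + x ^ 3 + y ^ 3 + z ^ 3, d + m)) (x + y + z)
      ≤ 8 * ∫⁻ p, F p := by
  set E : Set (ℝ × ℝ × ℝ) :=
    {p | |p.1 - p.2.2 / 3| ≤ |p.2.2| / 9 ∧ |p.2.1 - p.2.2 / 3| ≤ |p.2.2| / 9}
  have hE : MeasurableSet E :=
    measurableSet_le_and_le (by fun_prop) (by fun_prop) (by fun_prop) (by fun_prop)
  set G : ℝ × ℝ × ℝ → ℝ≥0∞ := fun p => ENNReal.ofReal |p.2.2| *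
    F (c + p.1 ^ 3 + p.2.1 ^ 3 + (p.2.2 - p.1 - p.2.1) ^ 3, d + p.2.2)
  have hG : Measurable G := by fun_prop
  have hEG : Measurable (E.indicator G) := hG.indicator hE
  have hshift : ∀ x y : ℝ, ∫⁻ z,
      {m : ℝ | |x - m / 3| ≤ |m| / 9 ∧ |y - m / 3| ≤ |m| / 9}.indicator
        (fun m => ENNReal.ofReal |m| * F (c + x ^ 3 + y ^ 3 + z ^ 3, d + m)) (x + y + z) =
      ∫⁻ m, E.indicator G (x, y, m) := by
    intro x y
    rw [← lintegral_add_left_eq_self (fun m => E.indicator G (x, y, m)) (x + y)]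
    refine lintegral_congr fun z => ?_
    simp only [indicator, E, G, mem_ofPred_eq]
    congr 5
    ring
  simp_rw [hshift]
  have hswap : ∫⁻ x, ∫⁻ y, ∫⁻ m, E.indicator G (x, y, m) =
      ∫⁻ m, ∫⁻ x, ∫⁻ y, E.indicator G (x, y, m) := by
    have h1 : ∀ x : ℝ, ∫⁻ y, ∫⁻ m, E.indicator G (x, y, m) =
        ∫⁻ m, ∫⁻ y, E.indicator G (x, y, m) := fun x =>
      lintegral_lintegral_swap (by fun_prop)
    simp_rw [h1]
    refine lintegral_lintegral_swap ?_
    refine Measurable.aemeasurable ?_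
    exact Measurable.lintegral_prod_right' (f := fun q : (ℝ × ℝ) × ℝ =>
      E.indicator G (q.1.1, q.2, q.1.2)) (by fun_prop)
  rw [hswap]
  have hm : ∀ m : ℝ, ∫⁻ x, ∫⁻ y, E.indicator G (x, y, m) ≤ 8 * ∫⁻ τ, F (τ, d + m) := by
    intro m
    have h := lintegral_cubic_disc_le m (c + m ^ 3 / 9) (F := fun τ => F (τ, d + m)) (by fun_prop)
    refine le_trans (le_of_eq ?_) h
    rw [← lintegral_add_right_eq_self (fun x => ∫⁻ y, E.indicator G (x, y, m)) (m / 3)]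
    refine lintegral_congr fun u => ?_
    rw [← lintegral_add_right_eq_self (fun y => E.indicator G (u + m / 3, y, m)) (m / 3)]
    refine lintegral_congr fun v => ?_
    simp only [indicator, E, G, mem_ofPred_eq, add_sub_cancel_right]
    congr 4
    ring
  refine (lintegral_mono hm).trans ?_
  rw [lintegral_const_mul _ (Measurable.lintegral_prod_left' (f := fun q : ℝ × ℝ =>
      F (q.1, d + q.2)) (by fun_prop)),
    lintegral_add_left_eq_self (fun m => ∫⁻ τ, F (τ, m)) d, Measure.volume_eq_prod,
    lintegral_prod_symm _ hF.aemeasurable]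

theorem ennreal_rpow_neg_anti {α : ℝ} (hα : 0 ≤ α) {x y : ℝ≥0∞} (h : x ≤ y) :
    y ^ (-α) ≤ x ^ (-α) := by
  rw [ENNReal.rpow_neg, ENNReal.rpow_neg, ENNReal.inv_le_inv]
  exact ENNReal.rpow_le_rpow h hα

theorem setLIntegral_Ioc_rpow_neg {α : ℝ} (hα : α < 1) {N : ℝ} (hN : 0 < N) :
    ∫⁻ t in Ioc 0 N, ENNReal.ofReal |t| ^ (-α) =
      ENNReal.ofReal (1 / (1 - α)) * ENNReal.ofReal N ^ (1 - α) := by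
  have h1 : ∫⁻ t in Ioc 0 N, ENNReal.ofReal |t| ^ (-α) =
      ∫⁻ t in Ioc 0 N, ENNReal.ofReal (t ^ (-α)) := by
    refine setLIntegral_congr_fun measurableSet_Ioc fun t ht => ?_
    rw [abs_of_pos ht.1, ENNReal.ofReal_rpow_of_pos ht.1]
  have hint : IntervalIntegrable (fun t : ℝ => t ^ (-α)) volume 0 N :=
    intervalIntegral.intervalIntegrable_rpow' (by linarith)
  rw [h1, ← ofReal_integral_eq_lintegral_ofReal
    ((intervalIntegrable_iff_integrableOn_Ioc_of_le hN.le).1 hint)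
    ((ae_restrict_iff' measurableSet_Ioc).2 (Filter.Eventually.of_forall fun t ht =>
      Real.rpow_nonneg ht.1.le _)), ← intervalIntegral.integral_of_le hN.le,
    integral_rpow (Or.inl (by linarith)), ENNReal.ofReal_rpow_of_pos hN,
    ← ENNReal.ofReal_mul (by rw [one_div, inv_nonneg]; linarith)]
  rw [Real.zero_rpow (by linarith)]
  congr 1
  rw [show -α + 1 = 1 - α by ring]
  ring

/-- A power singularity, centred anywhere, integrated over an interval of half-length `N`. -/
theorem setLIntegral_abs_sub_rpow_neg_le {α : ℝ} (hα0 : 0 < α) (hα : α < 1) {N : ℝ} (hN : 0 < N)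
    (a : ℝ) :
    ∫⁻ x in Icc (-N) N, ENNReal.ofReal |x - a| ^ (-α) ≤
      ENNReal.ofReal (2 / (1 - α) + 2) * ENNReal.ofReal N ^ (1 - α) := by
  set n := ENNReal.ofReal N with hn
  have hn0 : n ≠ 0 := by simpa [hn] using hN
  have hnt : n ≠ ⊤ := ENNReal.ofReal_ne_top
  have hcentral : ∫⁻ x, (Icc (-N) N).indicator (fun t => ENNReal.ofReal |t| ^ (-α)) (x - a) ≤
      ENNReal.ofReal (2 / (1 - α)) * n ^ (1 - α) := by
    rw [lintegral_sub_right_eq_self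
      (fun t => (Icc (-N) N).indicator (fun t => ENNReal.ofReal |t| ^ (-α)) t) a]
    have hpos := setLIntegral_Ioc_rpow_neg hα hN
    have hneg : ∫⁻ t, (Ioc 0 N).indicator (fun t => ENNReal.ofReal |t| ^ (-α)) (-t) =
        ENNReal.ofReal (1 / (1 - α)) * n ^ (1 - α) := by
      rw [lintegral_neg_eq_self (fun t => (Ioc 0 N).indicator
        (fun t => ENNReal.ofReal |t| ^ (-α)) t), lintegral_indicator measurableSet_Ioc, hpos]
    rw [← lintegral_indicator measurableSet_Ioc] at hpos
    have hsum : ENNReal.ofReal (2 / (1 - α)) * n ^ (1 - α) =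
        ENNReal.ofReal (1 / (1 - α)) * n ^ (1 - α) + ENNReal.ofReal (1 / (1 - α)) * n ^ (1 - α) := by
      have : 0 ≤ 1 / (1 - α) := by rw [one_div, inv_nonneg]; linarith
      rw [← add_mul, ← ENNReal.ofReal_add this this]
      congr 2; ring
    rw [hsum]
    nth_rewrite 1 [← hpos]
    rw [← hneg, ← lintegral_add_left (Measurable.indicator (by fun_prop) measurableSet_Ioc)]
    have h0 : ∀ᵐ t : ℝ, t ≠ 0 := by simp [ae_iff]
    refine lintegral_mono_ae ?_
    filter_upwards [h0] with t ht
    by_cases hmem : t ∈ Icc (-N) N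
    · rw [indicator_of_mem hmem]
      rcases lt_or_gt_of_ne ht with h | h
      · rw [indicator_of_mem (s := Ioc 0 N) (a := -t) ⟨by linarith, by linarith [hmem.1]⟩, abs_neg]
        exact le_add_self
      · rw [indicator_of_mem (s := Ioc 0 N) (a := t) ⟨h, hmem.2⟩]
        exact le_self_add
    · rw [indicator_of_notMem hmem]; exact zero_le
  have hfar : ∫⁻ _ in Icc (-N) N, n ^ (-α) = ENNReal.ofReal 2 * n ^ (1 - α) := by
    rw [setLIntegral_const, Real.volume_Icc, show N - -N = 2 * N by ring,
      ENNReal.ofReal_mul (by norm_num), ← hn, sub_eq_add_neg, ENNReal.rpow_add _ _ hn0 hnt,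
      ENNReal.rpow_one]
    ring
  rw [ENNReal.ofReal_add (by have : 0 < 1 - α := by linarith
                             positivity) (by norm_num), add_mul]
  refine le_trans ?_ (add_le_add hcentral hfar.le)
  rw [← lintegral_indicator measurableSet_Icc, ← lintegral_indicator measurableSet_Icc,
    ← lintegral_add_right _ (Measurable.indicator (by fun_prop) measurableSet_Icc)]
  refine lintegral_mono fun x => ?_
  by_cases hmem : x ∈ Icc (-N) N
  · rw [indicator_of_mem hmem, indicator_of_mem hmem]
    by_cases hx : |x - a| ≤ N
    · rw [indicator_of_mem (by exact abs_le.1 hx)]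
      exact le_self_add
    · refine le_trans ?_ le_add_self
      refine ennreal_rpow_neg_anti hα0.le ?_
      exact ENNReal.ofReal_le_ofReal (le_of_not_ge hx)
  · rw [indicator_of_notMem hmem]; exact zero_le

/-- Integral of a negative power of a function which is expanding on the domain. -/
theorem setLIntegral_rpow_neg_of_expanding_le {α : ℝ} (hα0 : 0 < α) (hα : α < 1) {N : ℝ}
    (hN : 0 < N) {S : Set ℝ} (hS : S ⊆ Icc (-N) N) {f : ℝ → ℝ} {l : ℝ} (hl : 0 ≤ l)
    (hf : ∀ x ∈ S, ∀ y ∈ S, l * |x - y| ≤ |f x - f y|) :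
    ∫⁻ x in S, ENNReal.ofReal (1 + |f x|) ^ (-α) ≤
      ENNReal.ofReal (l / 2) ^ (-α) *
        (ENNReal.ofReal (2 / (1 - α) + 2) * ENNReal.ofReal N ^ (1 - α)) := by
  rcases S.eq_empty_or_nonempty with rfl | hne
  · simp
  obtain ⟨x₀, hx₀, hmin⟩ : ∃ x₀ ∈ S, ∀ x ∈ S, |f x₀| ≤ |f x| + 1 := by
    have hbdd : BddBelow ((fun x => |f x|) '' S) := ⟨0, by rintro _ ⟨x, -, rfl⟩; positivity⟩
    obtain ⟨_, ⟨x₀, hx₀, rfl⟩, hlt⟩ := exists_lt_of_csInf_lt (hne.image fun x => |f x|)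
      (lt_add_one (sInf ((fun x => |f x|) '' S)))
    refine ⟨x₀, hx₀, fun x hx => ?_⟩
    have := csInf_le hbdd (mem_image_of_mem _ hx)
    simp only at hlt this
    linarith
  have hpt : ∀ x ∈ S, ENNReal.ofReal (1 + |f x|) ^ (-α) ≤
      ENNReal.ofReal (l / 2) ^ (-α) * ENNReal.ofReal |x - x₀| ^ (-α) := by
    intro x hx
    rw [← ENNReal.mul_rpow_of_ne_top ENNReal.ofReal_ne_top ENNReal.ofReal_ne_top,
      ← ENNReal.ofReal_mul (by positivity)]
    refine ennreal_rpow_neg_anti hα0.le (ENNReal.ofReal_le_ofReal ?_)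
    have h1 := hf x hx x₀ hx₀
    have h2 := hmin x hx
    have h3 := abs_sub (f x) (f x₀)
    linarith
  calc ∫⁻ x in S, ENNReal.ofReal (1 + |f x|) ^ (-α)
      ≤ ∫⁻ x in S, ENNReal.ofReal (l / 2) ^ (-α) * ENNReal.ofReal |x - x₀| ^ (-α) :=
        setLIntegral_mono (by fun_prop) hpt
    _ ≤ ∫⁻ x in Icc (-N) N, ENNReal.ofReal (l / 2) ^ (-α) * ENNReal.ofReal |x - x₀| ^ (-α) :=
        lintegral_mono_set hS
    _ = ENNReal.ofReal (l / 2) ^ (-α) * ∫⁻ x in Icc (-N) N, ENNReal.ofReal |x - x₀| ^ (-α) :=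
        lintegral_const_mul _ (by fun_prop)
    _ ≤ _ := by
        gcongr
        exact setLIntegral_abs_sub_rpow_neg_le hα0 hα hN x₀

theorem measurableSet_setOf_and {X : Type*} [MeasurableSpace X] {p q : X → Prop}
    (hp : MeasurableSet {x | p x}) (hq : MeasurableSet {x | q x}) :
    MeasurableSet {x | p x ∧ q x} :=
  hp.inter hq

theorem measurableSet_setOf_or {X : Type*} [MeasurableSpace X] {p q : X → Prop}
    (hp : MeasurableSet {x | p x}) (hq : MeasurableSet {x | q x}) :
    MeasurableSet {x | p x ∨ q x} :=
  hp.union hq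

theorem setLIntegral_rpow_neg_quadratic_le {α : ℝ} (hα0 : 0 < α) (hα : α < 1) {δ N : ℝ}
    (hδ : 0 < δ) (hN : 0 < N) (c k e : ℝ) :
    ∫⁻ x in {x : ℝ | |x| ≤ N ∧ δ * N ≤ |2 * x + e|},
        ENNReal.ofReal (1 + |c + k * (x ^ 2 + e * x)|) ^ (-α) ≤
      2 * ENNReal.ofReal (δ / 2) ^ (-α) * ENNReal.ofReal (2 / (1 - α) + 2) *
        ENNReal.ofReal N ^ (1 - 2 * α) * ENNReal.ofReal |k| ^ (-α) := by
  set P : Set ℝ := {x : ℝ | |x| ≤ N ∧ δ * N ≤ 2 * x + e}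
  set M : Set ℝ := {x : ℝ | |x| ≤ N ∧ 2 * x + e ≤ -(δ * N)}
  have hsub : {x : ℝ | |x| ≤ N ∧ δ * N ≤ |2 * x + e|} ⊆ P ∪ M := by
    rintro x ⟨h1, h2⟩
    rcases le_abs.1 h2 with h | h
    · exact Or.inl ⟨h1, h⟩
    · exact Or.inr ⟨h1, by linarith⟩
  have hfac : ∀ x y : ℝ, (c + k * (x ^ 2 + e * x)) - (c + k * (y ^ 2 + e * y)) =
      k * (x - y) * (((2 * x + e) + (2 * y + e)) / 2) := by intros; ring
  have hP := setLIntegral_rpow_neg_of_expanding_le hα0 hα hN (S := P)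
    (fun x hx => abs_le.1 hx.1) (f := fun x => c + k * (x ^ 2 + e * x)) (l := |k| * (δ * N))
    (by positivity) (fun x hx y hy => by
      rw [hfac, abs_mul, abs_mul]
      have : δ * N ≤ |((2 * x + e) + (2 * y + e)) / 2| := by
        refine le_trans ?_ (le_abs_self _); linarith [hx.2, hy.2]
      calc |k| * (δ * N) * |x - y| = |k| * |x - y| * (δ * N) := by ring
        _ ≤ _ := by gcongr)
  have hM := setLIntegral_rpow_neg_of_expanding_le hα0 hα hN (S := M)
    (fun x hx => abs_le.1 hx.1) (f := fun x => c + k * (x ^ 2 + e * x)) (l := |k| * (δ * N))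
    (by positivity) (fun x hx y hy => by
      rw [hfac, abs_mul, abs_mul]
      have : δ * N ≤ |((2 * x + e) + (2 * y + e)) / 2| := by
        refine le_trans ?_ (neg_le_abs _); linarith [hx.2, hy.2]
      calc |k| * (δ * N) * |x - y| = |k| * |x - y| * (δ * N) := by ring
        _ ≤ _ := by gcongr)
  refine (lintegral_mono_set hsub).trans ((lintegral_union_le _ _ _).trans
    ((add_le_add hP hM).trans_eq ?_))
  have hn0 : ENNReal.ofReal N ≠ 0 := by simpa using hN
  rw [← two_mul, show |k| * (δ * N) / 2 = (δ / 2) * N * |k| by ring,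
    ENNReal.ofReal_mul (by positivity), ENNReal.ofReal_mul (by positivity),
    ENNReal.mul_rpow_of_ne_top (by finiteness) ENNReal.ofReal_ne_top,
    ENNReal.mul_rpow_of_ne_top ENNReal.ofReal_ne_top ENNReal.ofReal_ne_top,
    show 1 - 2 * α = -α + (1 - α) by ring, ENNReal.rpow_add _ _ hn0 ENNReal.ofReal_ne_top]
  ring

/-- Sublevel estimate for the resonance function on the set where it is nondegenerate. -/
theorem lintegral_resonance_le_rpow {α : ℝ} (hα0 : 0 < α) (hα : α < 1) {δ N : ℝ}
    (hδ : 0 < δ) (hN : 0 < N) (c A : ℝ) :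
    ∫⁻ x, ∫⁻ y, {p : ℝ × ℝ | (|p.1| ≤ N ∧ |p.2| ≤ N) ∧ (δ * N ≤ |2 * p.1 + p.2 + A| ∨
        δ * N ≤ |2 * p.2 + p.1 + A| ∨ δ * N ≤ |p.1 - p.2|)}.indicator (fun p =>
        ENNReal.ofReal (1 + |c - 3 * ((p.1 + p.2) * (p.1 + A) * (p.2 + A))|) ^ (-α)) (x, y) ≤
      8 * ENNReal.ofReal (δ / 2) ^ (-α) * ENNReal.ofReal (2 / (1 - α) + 2) ^ 2 *
        ENNReal.ofReal 3 ^ (-α) * ENNReal.ofReal N ^ (2 - 3 * α) := by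
  set f : ℝ × ℝ → ℝ≥0∞ := fun p =>
    ENNReal.ofReal (1 + |c - 3 * ((p.1 + p.2) * (p.1 + A) * (p.2 + A))|) ^ (-α) with hf
  have hfm : Measurable f := by fun_prop
  set E₁ : Set (ℝ × ℝ) := {p | |p.2| ≤ N ∧ (|p.1| ≤ N ∧ δ * N ≤ |2 * p.1 + (p.2 + A)|)} with hE₁
  set E₃ : Set (ℝ × ℝ) := {p | |p.1 + p.2| ≤ 2 * N ∧
    (|p.1| ≤ N ∧ δ * N ≤ |2 * p.1 + (-(p.1 + p.2))|)} with hE₃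
  have hE₁m : MeasurableSet E₁ := measurableSet_setOf_and (measurableSet_le (by fun_prop) (by fun_prop))
    (measurableSet_le_and_le (by fun_prop) (by fun_prop) (by fun_prop) (by fun_prop))
  have hE₃m : MeasurableSet E₃ := measurableSet_setOf_and (measurableSet_le (by fun_prop) (by fun_prop))
    (measurableSet_le_and_le (by fun_prop) (by fun_prop) (by fun_prop) (by fun_prop))
  have hg₁ : Measurable (E₁.indicator f) := hfm.indicator hE₁m
  have hg₃ : Measurable (E₃.indicator f) := hfm.indicator hE₃m
  set K := 2 * ENNReal.ofReal (δ / 2) ^ (-α) * ENNReal.ofReal (2 / (1 - α) + 2) *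
        ENNReal.ofReal N ^ (1 - 2 * α) with hK
  have hn0 : ENNReal.ofReal N ≠ 0 := by simpa using hN
  -- integral over the strips of a singular weight
  have hstrip : ∀ R : ℝ, 0 < R → ∀ a : ℝ, ∫⁻ y, (Icc (-R) R).indicator
      (fun y => K * ENNReal.ofReal |3 * (y - a)| ^ (-α)) y ≤
      K * ENNReal.ofReal 3 ^ (-α) *
        (ENNReal.ofReal (2 / (1 - α) + 2) * ENNReal.ofReal R ^ (1 - α)) := by
    intro R hR a
    rw [lintegral_indicator measurableSet_Icc]
    have : ∀ y : ℝ, K * ENNReal.ofReal |3 * (y - a)| ^ (-α) =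
        K * ENNReal.ofReal 3 ^ (-α) * ENNReal.ofReal |y - a| ^ (-α) := by
      intro y
      rw [abs_mul, abs_of_pos (by norm_num : (0 : ℝ) < 3), ENNReal.ofReal_mul (by positivity),
        ENNReal.mul_rpow_of_ne_top ENNReal.ofReal_ne_top ENNReal.ofReal_ne_top, ← mul_assoc]
    simp_rw [this]
    rw [lintegral_const_mul _ (by fun_prop)]
    gcongr
    exact setLIntegral_abs_sub_rpow_neg_le hα0 hα hR a
  have h₁ : ∫⁻ y, ∫⁻ x, E₁.indicator f (x, y) ≤ K * ENNReal.ofReal 3 ^ (-α) *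
        (ENNReal.ofReal (2 / (1 - α) + 2) * ENNReal.ofReal N ^ (1 - α)) := by
    refine le_trans (lintegral_mono fun y => ?_) (hstrip N hN (-A))
    by_cases hy : |y| ≤ N
    · rw [indicator_of_mem (by exact abs_le.1 hy)]
      have h := setLIntegral_rpow_neg_quadratic_le hα0 hα hδ hN
        (c - 3 * (y * A * (y + A))) (-(3 * (y + A))) (y + A)
      rw [abs_neg, ← lintegral_indicator (measurableSet_le_and_le (by fun_prop) (by fun_prop)
        (by fun_prop) (by fun_prop))] at h
      rw [sub_neg_eq_add]
      refine le_trans (lintegral_mono fun x => ?_) h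
      simp only [indicator, hE₁, mem_ofPred_eq, hy, true_and, hf]
      refine le_of_eq ?_
      congr 4
      ring_nf
    · rw [indicator_of_notMem (by exact fun h => hy (abs_le.2 h))]
      refine le_of_eq ?_
      simp [E₁, indicator, hy]
  have h₁' : ∫⁻ x, ∫⁻ y, E₁.indicator f (x, y) ≤ K * ENNReal.ofReal 3 ^ (-α) *
        (ENNReal.ofReal (2 / (1 - α) + 2) * ENNReal.ofReal N ^ (1 - α)) := by
    rw [lintegral_lintegral_swap (by fun_prop)]
    exact h₁
  have h₃ : ∫⁻ x, ∫⁻ y, E₃.indicator f (x, y) ≤ K * ENNReal.ofReal 3 ^ (-α) *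
        (ENNReal.ofReal (2 / (1 - α) + 2) * ENNReal.ofReal (2 * N) ^ (1 - α)) := by
    rw [lintegral_lintegral_sub_swap (G := fun x y => E₃.indicator f (x, y))
      (by simpa [Function.uncurry_def] using hg₃)]
    refine le_trans (lintegral_mono fun r => ?_) (hstrip (2 * N) (by positivity) 0)
    by_cases hr : |r| ≤ 2 * N
    · rw [indicator_of_mem (by exact abs_le.1 hr)]
      have h := setLIntegral_rpow_neg_quadratic_le hα0 hα hδ hN
        (c - 3 * (r * A * (r + A))) (3 * r) (-r)
      rw [← lintegral_indicator (measurableSet_le_and_le (by fun_prop) (by fun_prop)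
        (by fun_prop) (by fun_prop))] at h
      rw [sub_zero]
      refine le_trans (lintegral_mono fun x => ?_) h
      simp only [indicator, hE₃, mem_ofPred_eq, add_sub_cancel, hr, true_and, hf]
      refine le_of_eq ?_
      congr 4
      ring_nf
    · rw [indicator_of_notMem (by exact fun h => hr (abs_le.2 h))]
      refine le_of_eq ?_
      simp [E₃, indicator, hr]
  have htwo : ENNReal.ofReal (2 * N) ^ (1 - α) ≤ 2 * ENNReal.ofReal N ^ (1 - α) := by
    rw [ENNReal.ofReal_mul (by norm_num), ENNReal.mul_rpow_of_nonneg _ _ (by linarith)]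
    gcongr
    rw [show ENNReal.ofReal 2 = 2 by norm_num]
    calc (2 : ℝ≥0∞) ^ (1 - α) ≤ 2 ^ (1 : ℝ) :=
          ENNReal.rpow_le_rpow_of_exponent_le (by norm_num) (by linarith)
      _ = 2 := ENNReal.rpow_one _
  have hfinal : 8 * ENNReal.ofReal (δ / 2) ^ (-α) * ENNReal.ofReal (2 / (1 - α) + 2) ^ 2 *
        ENNReal.ofReal 3 ^ (-α) * ENNReal.ofReal N ^ (2 - 3 * α) =
      K * ENNReal.ofReal 3 ^ (-α) *
        (ENNReal.ofReal (2 / (1 - α) + 2) * ENNReal.ofReal N ^ (1 - α)) +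
      K * ENNReal.ofReal 3 ^ (-α) *
        (ENNReal.ofReal (2 / (1 - α) + 2) * ENNReal.ofReal N ^ (1 - α)) +
      K * ENNReal.ofReal 3 ^ (-α) *
        (ENNReal.ofReal (2 / (1 - α) + 2) * (2 * ENNReal.ofReal N ^ (1 - α))) := by
    rw [hK, show 2 - 3 * α = (1 - 2 * α) + (1 - α) by ring,
      ENNReal.rpow_add _ _ hn0 ENNReal.ofReal_ne_top]
    ring
  rw [hfinal]
  refine le_trans ?_ (add_le_add (add_le_add h₁' h₁) (h₃.trans (by gcongr)))
  rw [← lintegral_add_left (by fun_prop), ← lintegral_add_left (by fun_prop)]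
  refine lintegral_mono fun x => ?_
  rw [← lintegral_add_left (by fun_prop), ← lintegral_add_left (by fun_prop)]
  refine lintegral_mono fun y => ?_
  refine indicator_le' (f := f) (g := fun p => E₁.indicator f p + E₁.indicator f (p.2, p.1) +
    E₃.indicator f p) ?_ (fun _ _ => zero_le) (x, y)
  rintro ⟨x, y⟩ ⟨⟨hx, hy⟩, h | h | h⟩
  · refine le_trans ?_ (le_add_right le_self_add)
    rw [indicator_of_mem (s := E₁) ⟨hy, hx, by rwa [← add_assoc]⟩]
  · refine le_trans ?_ (le_add_right le_add_self)
    rw [indicator_of_mem (s := E₁) ⟨hx, hy, by rwa [← add_assoc]⟩]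
    simp only [hf]
    refine le_of_eq ?_
    congr 4
    ring
  · refine le_trans ?_ le_add_self
    rw [indicator_of_mem (s := E₃) ⟨(abs_add_le x y).trans (by simp only at hx hy; linarith), hx, by
      rwa [show 2 * (x, y).1 + -((x, y).1 + (x, y).2) = (x, y).1 - (x, y).2 by ring]⟩]

theorem le_mul_one_add_rpow_neg {γ β N : ℝ} (hγ : 0 ≤ γ) (hβ : β ≤ -γ)
    {J K : ℝ≥0∞} (h₁ : 1 ≤ N → J ≤ K * ENNReal.ofReal N ^ β) (h₂ : N ≤ 1 → J ≤ K) :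
    J ≤ K * 2 ^ γ * ENNReal.ofReal (1 + N) ^ (-γ) := by
  have h22 : (2 : ℝ≥0∞) ^ γ * 2 ^ (-γ) = 1 := by
    rw [← ENNReal.rpow_add _ _ (by norm_num) (by norm_num)]; simp
  rcases le_total 1 N with h | h
  · refine (h₁ h).trans ?_
    rw [mul_assoc]
    gcongr
    calc ENNReal.ofReal N ^ β ≤ ENNReal.ofReal N ^ (-γ) :=
          ENNReal.rpow_le_rpow_of_exponent_le (by simpa using h) hβ
      _ = 2 ^ γ * ENNReal.ofReal (2 * N) ^ (-γ) := by
          rw [ENNReal.ofReal_mul (by norm_num),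
            ENNReal.mul_rpow_of_ne_top ENNReal.ofReal_ne_top ENNReal.ofReal_ne_top, ← mul_assoc,
            show ENNReal.ofReal 2 = 2 by norm_num, h22, one_mul]
      _ ≤ _ := by
          refine mul_le_mul' le_rfl ?_
          exact ennreal_rpow_neg_anti hγ (ENNReal.ofReal_le_ofReal (by linarith))
  · refine (h₂ h).trans ?_
    rw [mul_assoc]
    refine le_mul_of_one_le_right' ?_
    rw [← h22]
    refine mul_le_mul' le_rfl ?_
    refine ennreal_rpow_neg_anti hγ ?_
    rw [← show ENNReal.ofReal 2 = 2 by norm_num]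
    exact ENNReal.ofReal_le_ofReal (by linarith)

theorem ofReal_one_add_abs_rpow_neg_le_one {α : ℝ} (hα : 0 ≤ α) (v : ℝ) :
    ENNReal.ofReal (1 + |v|) ^ (-α) ≤ 1 := by
  refine (ennreal_rpow_neg_anti hα (x := 1) ?_).trans_eq (ENNReal.one_rpow _)
  rw [ENNReal.one_le_ofReal]
  linarith [abs_nonneg v]

/-- Uniform resonance estimate in two low-frequency variables. -/
theorem exists_lintegral_resonance_le {α γ δ : ℝ} (hα0 : 0 < α) (hα : α < 1) (hγ : 0 ≤ γ)
    (hγα : γ ≤ 3 * α - 2) (hδ : 0 < δ) :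
    ∃ C : ℝ≥0∞, C ≠ ⊤ ∧ ∀ N : ℝ, 0 ≤ N → ∀ c A : ℝ,
    ∫⁻ x, ∫⁻ y, {p : ℝ × ℝ | (|p.1| ≤ N ∧ |p.2| ≤ N) ∧ (δ * N ≤ |2 * p.1 + p.2 + A| ∨
        δ * N ≤ |2 * p.2 + p.1 + A| ∨ δ * N ≤ |p.1 - p.2|)}.indicator (fun p =>
        ENNReal.ofReal (1 + |c - 3 * ((p.1 + p.2) * (p.1 + A) * (p.2 + A))|) ^ (-α)) (x, y) ≤
      C * ENNReal.ofReal (1 + N) ^ (-γ) := by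
  set K := 8 * ENNReal.ofReal (δ / 2) ^ (-α) * ENNReal.ofReal (2 / (1 - α) + 2) ^ 2 *
        ENNReal.ofReal 3 ^ (-α)
  have hK : K ≠ ⊤ := by
    have h1 : ENNReal.ofReal (δ / 2) ^ (-α) ≠ ⊤ :=
      ENNReal.rpow_ne_top_of_ne_zero (by simpa using hδ) ENNReal.ofReal_ne_top
    have h2 : ENNReal.ofReal 3 ^ (-α) ≠ ⊤ :=
      ENNReal.rpow_ne_top_of_ne_zero (by simp) ENNReal.ofReal_ne_top
    finiteness
  have h2γ : (2 : ℝ≥0∞) ^ γ ≠ ⊤ := ENNReal.rpow_ne_top_of_nonneg hγ (by norm_num)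
  refine ⟨(K + 4) * 2 ^ γ, by finiteness, fun N hN c A => ?_⟩
  refine le_mul_one_add_rpow_neg (β := 2 - 3 * α) hγ (by linarith) (fun h => ?_) (fun h => ?_)
  · refine (lintegral_resonance_le_rpow hα0 hα hδ (by linarith) c A).trans ?_
    gcongr
    exact le_self_add
  · refine le_trans ?_ le_add_self
    have hb : ∀ p : ℝ × ℝ, {p : ℝ × ℝ | (|p.1| ≤ N ∧ |p.2| ≤ N) ∧ (δ * N ≤ |2 * p.1 + p.2 + A| ∨
        δ * N ≤ |2 * p.2 + p.1 + A| ∨ δ * N ≤ |p.1 - p.2|)}.indicator (fun p =>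
        ENNReal.ofReal (1 + |c - 3 * ((p.1 + p.2) * (p.1 + A) * (p.2 + A))|) ^ (-α)) p ≤
        (Icc (-1 : ℝ) 1).indicator 1 p.1 * (Icc (-1 : ℝ) 1).indicator 1 p.2 := by
      refine indicator_le' ?_ (fun _ _ => zero_le)
      rintro ⟨x, y⟩ ⟨⟨hx, hy⟩, -⟩
      rw [indicator_of_mem (by exact abs_le.1 (hx.trans h)),
        indicator_of_mem (by exact abs_le.1 (hy.trans h))]
      simpa using ofReal_one_add_abs_rpow_neg_le_one hα0.le _
    refine (lintegral_mono fun x => lintegral_mono fun y => hb (x, y)).trans ?_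
    have hI : ∫⁻ x, (Icc (-1 : ℝ) 1).indicator (1 : ℝ → ℝ≥0∞) x = 2 := by
      rw [lintegral_indicator_one measurableSet_Icc, Real.volume_Icc]; norm_num
    have hm : Measurable ((Icc (-1 : ℝ) 1).indicator (1 : ℝ → ℝ≥0∞)) :=
      measurable_one.indicator measurableSet_Icc
    simp only
    simp_rw [lintegral_const_mul _ hm, hI]
    rw [lintegral_mul_const _ hm, hI]
    norm_num

/-- Uniform resonance estimate in one variable. -/
theorem exists_lintegral_quadratic_resonance_le {α γ : ℝ} (hα0 : 0 < α) (hα : α < 1) (hγ : 0 ≤ γ)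
    (hγα : γ ≤ 3 * α - 2) :
    ∃ C : ℝ≥0∞, C ≠ ⊤ ∧ ∀ c m : ℝ,
    ∫⁻ x in {x : ℝ | |x| ≤ 2 * |m| ∧ |m| / 9 ≤ |2 * x + m|},
        ENNReal.ofReal |m| * ENNReal.ofReal (1 + |c - 3 * m * (x ^ 2 + m * x)|) ^ (-α) ≤
      C * ENNReal.ofReal (1 + |m|) ^ (-γ) := by
  set K := 2 * ENNReal.ofReal (1 / 18 / 2) ^ (-α) * ENNReal.ofReal (2 / (1 - α) + 2) *
    ENNReal.ofReal 2 ^ (1 - 2 * α) * ENNReal.ofReal 3 ^ (-α)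
  have hK : K ≠ ⊤ := by
    have h1 : ENNReal.ofReal (1 / 18 / 2) ^ (-α) ≠ ⊤ :=
      ENNReal.rpow_ne_top_of_ne_zero (by simp) ENNReal.ofReal_ne_top
    have h2 : ENNReal.ofReal 3 ^ (-α) ≠ ⊤ :=
      ENNReal.rpow_ne_top_of_ne_zero (by simp) ENNReal.ofReal_ne_top
    have h3 : ENNReal.ofReal 2 ^ (1 - 2 * α) ≠ ⊤ :=
      ENNReal.rpow_ne_top_of_ne_zero (by simp) ENNReal.ofReal_ne_top
    finiteness
  have h2γ : (2 : ℝ≥0∞) ^ γ ≠ ⊤ := ENNReal.rpow_ne_top_of_nonneg hγ (by norm_num)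
  refine ⟨(K + 4) * 2 ^ γ, by finiteness, fun c m => ?_⟩
  rw [lintegral_const_mul _ (by fun_prop)]
  refine le_mul_one_add_rpow_neg (β := 2 - 3 * α) hγ (by linarith)
    (fun h => ?_) (fun h => ?_)
  · have hm : 0 < |m| := by linarith
    have hm0 : ENNReal.ofReal |m| ≠ 0 := by simpa using hm
    have h := setLIntegral_rpow_neg_quadratic_le hα0 hα (δ := 1 / 18) (N := 2 * |m|) (by norm_num)
      (by positivity) c (-(3 * m)) m
    rw [show 1 / 18 * (2 * |m|) = |m| / 9 by ring] at h
    have h' := mul_le_mul_right h (ENNReal.ofReal |m|)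
    have e : ∀ x : ℝ, c + -(3 * m) * (x ^ 2 + m * x) = c - 3 * m * (x ^ 2 + m * x) := by
      intro x; ring
    simp_rw [e] at h'
    refine h'.trans ?_
    refine le_trans (le_of_eq ?_) (mul_le_mul_left le_self_add _)
    rw [abs_neg, abs_mul, abs_of_pos (by norm_num : (0 : ℝ) < 3), ENNReal.ofReal_mul (by norm_num),
      ENNReal.ofReal_mul (by norm_num),
      ENNReal.mul_rpow_of_ne_top ENNReal.ofReal_ne_top ENNReal.ofReal_ne_top,
      ENNReal.mul_rpow_of_ne_top ENNReal.ofReal_ne_top ENNReal.ofReal_ne_top,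
      show 2 - 3 * α = 1 + (1 - 2 * α) + (-α) by ring,
      ENNReal.rpow_add _ _ hm0 ENNReal.ofReal_ne_top,
      ENNReal.rpow_add _ _ hm0 ENNReal.ofReal_ne_top, ENNReal.rpow_one]
    ring
  · refine le_trans ?_ le_add_self
    have h1 : ENNReal.ofReal |m| ≤ 1 := by simpa using h
    have h2 : ∫⁻ x in {x : ℝ | |x| ≤ 2 * |m| ∧ |m| / 9 ≤ |2 * x + m|},
        ENNReal.ofReal (1 + |c - 3 * m * (x ^ 2 + m * x)|) ^ (-α) ≤ 4 := by
      calc _ ≤ ∫⁻ x in Icc (-2 : ℝ) 2,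
            ENNReal.ofReal (1 + |c - 3 * m * (x ^ 2 + m * x)|) ^ (-α) :=
            lintegral_mono_set fun x hx => abs_le.1 (hx.1.trans (by linarith))
        _ ≤ ∫⁻ x in Icc (-2 : ℝ) 2, 1 :=
            lintegral_mono fun x => ofReal_one_add_abs_rpow_neg_le_one hα0.le _
        _ = 4 := by
            rw [setLIntegral_const, Real.volume_Icc]; norm_num
    calc _ ≤ 1 * (4 : ℝ≥0∞) := mul_le_mul' h1 h2
      _ = 4 := one_mul _

/-- Frequency region treated by the bilinear estimate in the pair `(a, b)`. -/
def BilinearRegion (a b x y : ℝ) : Prop :=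
  (|b| ≤ |a| ∧ |a| * |a + b + x + y| ≤ 100 * |a ^ 2 - b ^ 2|) ∧
    ((|x| ≤ |a| ∧ |y| ≤ |a|) ∧ (1 / 100 * |a| ≤ |2 * x + y + (a + b)| ∨
      1 / 100 * |a| ≤ |2 * y + x + (a + b)| ∨ 1 / 100 * |a| ≤ |x - y|))

/-- Frequency region treated by the trilinear estimate in the triple `(x, y, z)`. -/
def TrilinearRegion (x y z k : ℝ) : Prop :=
  (|x - (x + y + z) / 3| ≤ |x + y + z| / 9 ∧ |y - (x + y + z) / 3| ≤ |x + y + z| / 9) ∧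
    (|k| ≤ 2 * |x + y + z| ∧ |x + y + z| / 9 ≤ |2 * k + (x + y + z)|)

theorem trilinearRegion_of_close {x y z k t r : ℝ} (hx : |x - t| ≤ |t| / 20)
    (hy : |y - t| ≤ |t| / 20) (hz : |z - t| ≤ |t| / 20) (hk : |k - r * t| ≤ |t| / 5)
    (hr : r = 1 ∨ r = -1 ∨ r = -4) :
    TrilinearRegion x y z k := by
  unfold TrilinearRegion
  rcases abs_cases t with ⟨ht, h0⟩ | ⟨ht, h0⟩ <;> rw [ht] at hx hy hz hk <;>
    rw [abs_le] at hx hy hz hk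
  · rw [abs_of_nonneg (a := x + y + z) (by linarith)]
    rcases hr with rfl | rfl | rfl
    · exact ⟨⟨abs_le.2 ⟨by linarith, by linarith⟩, abs_le.2 ⟨by linarith, by linarith⟩⟩,
        abs_le.2 ⟨by linarith, by linarith⟩, le_abs.2 (Or.inl (by linarith))⟩
    · exact ⟨⟨abs_le.2 ⟨by linarith, by linarith⟩, abs_le.2 ⟨by linarith, by linarith⟩⟩,
        abs_le.2 ⟨by linarith, by linarith⟩, le_abs.2 (Or.inl (by linarith))⟩
    · exact ⟨⟨abs_le.2 ⟨by linarith, by linarith⟩, abs_le.2 ⟨by linarith, by linarith⟩⟩,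
        abs_le.2 ⟨by linarith, by linarith⟩, le_abs.2 (Or.inr (by linarith))⟩
  · rw [abs_of_nonpos (a := x + y + z) (by linarith)]
    rcases hr with rfl | rfl | rfl
    · exact ⟨⟨abs_le.2 ⟨by linarith, by linarith⟩, abs_le.2 ⟨by linarith, by linarith⟩⟩,
        abs_le.2 ⟨by linarith, by linarith⟩, le_abs.2 (Or.inr (by linarith))⟩
    · exact ⟨⟨abs_le.2 ⟨by linarith, by linarith⟩, abs_le.2 ⟨by linarith, by linarith⟩⟩,
        abs_le.2 ⟨by linarith, by linarith⟩, le_abs.2 (Or.inr (by linarith))⟩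
    · exact ⟨⟨abs_le.2 ⟨by linarith, by linarith⟩, abs_le.2 ⟨by linarith, by linarith⟩⟩,
        abs_le.2 ⟨by linarith, by linarith⟩, le_abs.2 (Or.inl (by linarith))⟩

theorem trilinearRegion_or_of_resonant {a b x y S : ℝ} (ha : 0 < a) (hS : a + b + x + y = S)
    (hb : |b| ≤ a) (hx : |x| ≤ a) (hxS : |x + S| < a / 100)
    (hyS : |y + S| < a / 100) :
    (100 * (a - |x|) < |S| → 100 * (a - |y|) < |S| → False) ∧
      (|b + S| < a / 100 → TrilinearRegion b x y a) := by
  rw [abs_lt] at hxS hyS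
  constructor
  · intro h1 h2
    have hb' := abs_le.1 hb
    rcases abs_cases x with h | h <;> rcases abs_cases y with h' | h' <;>
      rcases abs_cases S with h'' | h'' <;> linarith
  · intro h
    rw [abs_lt] at h
    refine trilinearRegion_of_close (t := -a / 4) (r := -4) ?_ ?_ ?_ ?_ (by norm_num) <;>
      rw [abs_of_neg (a := -a / 4) (by linarith), abs_le] <;> constructor <;> linarith

theorem region_cover_of_pos {a b c d : ℝ} (ha : 0 < a) (hb : |b| ≤ a) (hc : |c| ≤ a)
    (hd : |d| ≤ a) :
    (BilinearRegion a b c d ∨ BilinearRegion a c b d ∨ BilinearRegion a d b c) ∨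
      (TrilinearRegion a b c d ∨ TrilinearRegion a b d c ∨ TrilinearRegion a c d b ∨
        TrilinearRegion b c d a) := by
  by_contra! hcon
  obtain ⟨⟨n1, n2, n3⟩, t1, t2, t3, t4⟩ := hcon
  set S := a + b + c + d with hS
  -- consequences of the failure of a bilinear region
  have hfail : ∀ {u x y : ℝ}, |u| ≤ a → |x| ≤ a → |y| ≤ a → a + u + x + y = S →
      ¬ BilinearRegion a u x y → |S| ≤ 100 * (a - |u|) →
      |x + S| < a / 100 ∧ |y + S| < a / 100 := by
    intro u x y hu hx hy hs hn h
    have h1 : |a ^ 2 - u ^ 2| = (a - |u|) * (a + |u|) := by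
      rw [abs_of_nonneg (by nlinarith [sq_abs u, abs_nonneg u]), ← sq_abs u]; ring
    have h2 : a * |S| ≤ 100 * |a ^ 2 - u ^ 2| := by
      rw [h1]; nlinarith [abs_nonneg u]
    by_contra hcon
    refine hn ⟨⟨by rwa [abs_of_pos ha], by rwa [abs_of_pos ha, hs]⟩, by
      rw [abs_of_pos ha]; exact ⟨hx, hy⟩, ?_⟩
    rw [abs_of_pos ha, show 2 * x + y + (a + u) = x + S by rw [← hs]; ring,
      show 2 * y + x + (a + u) = y + S by rw [← hs]; ring]
    by_cases h3 : |x + S| < a / 100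
    · exact Or.inr (Or.inl (by have := not_lt.1 (fun h4 => hcon ⟨h3, h4⟩); linarith))
    · exact Or.inl (by linarith)
  have hb' := abs_le.1 hb
  have hc' := abs_le.1 hc
  have hd' := abs_le.1 hd
  by_cases kb : |S| ≤ 100 * (a - |b|)
  · obtain ⟨p1, p2⟩ := hfail hb hc hd rfl n1 kb
    obtain ⟨q1, q2⟩ := trilinearRegion_or_of_resonant ha rfl hb hc p1 p2
    by_cases kc : |S| ≤ 100 * (a - |c|)
    · exact t4 (q2 (hfail hc hb hd (by rw [hS]; ring) n2 kc).1)
    · by_cases kd : |S| ≤ 100 * (a - |d|)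
      · exact t4 (q2 (hfail hd hb hc (by rw [hS]; ring) n3 kd).1)
      · exact q1 (not_le.1 kc) (not_le.1 kd)
  by_cases kc : |S| ≤ 100 * (a - |c|)
  · obtain ⟨p1, p2⟩ := hfail hc hb hd (by rw [hS]; ring) n2 kc
    by_cases kd : |S| ≤ 100 * (a - |d|)
    · have hcS := (hfail hd hb hc (by rw [hS]; ring) n3 kd).2
      exact t4 ((trilinearRegion_or_of_resonant ha rfl hb hc hcS p2).2 p1)
    · exact (trilinearRegion_or_of_resonant ha (by rw [hS]; ring) hc hb p1 p2).1
        (not_le.1 kb) (not_le.1 kd)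
  by_cases kd : |S| ≤ 100 * (a - |d|)
  · obtain ⟨p1, p2⟩ := hfail hd hb hc (by rw [hS]; ring) n3 kd
    exact (trilinearRegion_or_of_resonant ha (by rw [hS]; ring) hd hb p1 p2).1
      (not_le.1 kb) (not_le.1 kc)
  -- all frequencies have comparable size
  push Not at kb kc kd
  have hS4 : |S| ≤ 4 * a := by rw [abs_le]; constructor <;> linarith
  have key : ∀ {x y z k r : ℝ} (t : ℝ), |t| = a → |x - t| ≤ a / 20 → |y - t| ≤ a / 20 →
      |z - t| ≤ a / 20 → |k - r * t| ≤ a / 5 → (r = 1 ∨ r = -1 ∨ r = -4) →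
      TrilinearRegion x y z k := by
    intro x y z k r t ht h1 h2 h3 h4 hr
    rw [← ht] at h1 h2 h3 h4
    exact trilinearRegion_of_close h1 h2 h3 h4 hr
  rcases abs_cases b with ⟨eb, sb⟩ | ⟨eb, sb⟩ <;> rcases abs_cases c with ⟨ec, sc⟩ | ⟨ec, sc⟩ <;>
    rcases abs_cases d with ⟨ed, sd⟩ | ⟨ed, sd⟩
  · refine t1 (key (r := 1) a (abs_of_pos ha) ?_ ?_ ?_ ?_ (by norm_num)) <;> rw [abs_le] <;>
      constructor <;> linarith
  · refine t1 (key (r := -1) a (abs_of_pos ha) ?_ ?_ ?_ ?_ (by norm_num)) <;> rw [abs_le] <;>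
      constructor <;> linarith
  · refine t2 (key (r := -1) a (abs_of_pos ha) ?_ ?_ ?_ ?_ (by norm_num)) <;> rw [abs_le] <;>
      constructor <;> linarith
  · rcases abs_cases S with h | h <;> linarith
  · refine t3 (key (r := -1) a (abs_of_pos ha) ?_ ?_ ?_ ?_ (by norm_num)) <;> rw [abs_le] <;>
      constructor <;> linarith
  · rcases abs_cases S with h | h <;> linarith
  · rcases abs_cases S with h | h <;> linarith
  · refine t4 (key (r := -1) (-a) (by rw [abs_neg, abs_of_pos ha]) ?_ ?_ ?_ ?_ (by norm_num)) <;>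
      rw [abs_le] <;> constructor <;> linarith

theorem BilinearRegion.of_neg {a b x y : ℝ} (h : BilinearRegion (-a) (-b) (-x) (-y)) :
    BilinearRegion a b x y := by
  unfold BilinearRegion at *
  rw [show -a + -b + -x + -y = -(a + b + x + y) by ring,
    show 2 * -x + -y + (-a + -b) = -(2 * x + y + (a + b)) by ring,
    show 2 * -y + -x + (-a + -b) = -(2 * y + x + (a + b)) by ring,
    show -x - -y = -(x - y) by ring] at h
  simpa only [abs_neg, neg_sq] using h

theorem TrilinearRegion.of_neg {x y z k : ℝ} (h : TrilinearRegion (-x) (-y) (-z) (-k)) :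
    TrilinearRegion x y z k := by
  unfold TrilinearRegion at *
  rw [show -x + -y + -z = -(x + y + z) by ring,
    show -x - -(x + y + z) / 3 = -(x - (x + y + z) / 3) by ring,
    show -y - -(x + y + z) / 3 = -(y - (x + y + z) / 3) by ring,
    show 2 * -k + -(x + y + z) = -(2 * k + (x + y + z)) by ring] at h
  simpa only [abs_neg] using h

theorem region_cover_of_max {a b c d : ℝ} (hb : |b| ≤ |a|) (hc : |c| ≤ |a|) (hd : |d| ≤ |a|) :
    (BilinearRegion a b c d ∨ BilinearRegion a c b d ∨ BilinearRegion a d b c) ∨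
      (TrilinearRegion a b c d ∨ TrilinearRegion a b d c ∨ TrilinearRegion a c d b ∨
        TrilinearRegion b c d a) := by
  rcases lt_trichotomy a 0 with h | h | h
  · rw [abs_of_neg h] at hb hc hd
    rw [← abs_neg] at hb hc hd
    have := region_cover_of_pos (neg_pos.2 h) hb hc hd
    refine this.imp (Or.imp .of_neg (Or.imp .of_neg .of_neg))
      (Or.imp .of_neg (Or.imp .of_neg (Or.imp .of_neg .of_neg)))
  · subst h
    simp only [abs_zero, abs_nonpos_iff] at hb hc hd
    subst hb hc hd
    refine Or.inl (Or.inl ?_)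
    simp [BilinearRegion]
  · rw [abs_of_pos h] at hb hc hd
    exact region_cover_of_pos h hb hc hd

theorem exists_perm_region (v : Fin 4 → ℝ) : ∃ e : Equiv.Perm (Fin 4),
    BilinearRegion (v (e 0)) (v (e 1)) (v (e 2)) (v (e 3)) ∨
      TrilinearRegion (v (e 0)) (v (e 1)) (v (e 2)) (v (e 3)) := by
  obtain ⟨i, hi⟩ := Finite.exists_max fun i => |v i|
  have hsw : v (Equiv.swap 0 i 0) = v i := by simp
  have hmax : ∀ j, |v (Equiv.swap 0 i j)| ≤ |v (Equiv.swap 0 i 0)| := fun j => by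
    rw [hsw]; exact hi _
  have := region_cover_of_max (hmax 1) (hmax 2) (hmax 3)
  rcases this with (h | h | h) | (h | h | h | h)
  · exact ⟨Equiv.swap 0 i, Or.inl h⟩
  · exact ⟨(Equiv.swap 1 2).trans (Equiv.swap 0 i), Or.inl h⟩
  · exact ⟨((Equiv.swap 2 3).trans (Equiv.swap 1 3)).trans (Equiv.swap 0 i), Or.inl h⟩
  · exact ⟨Equiv.swap 0 i, Or.inr h⟩
  · exact ⟨(Equiv.swap 2 3).trans (Equiv.swap 0 i), Or.inr h⟩
  · exact ⟨((Equiv.swap 1 3).trans (Equiv.swap 2 3)).trans (Equiv.swap 0 i), Or.inr h⟩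
  · exact ⟨(finRotate 4).trans (Equiv.swap 0 i), Or.inr h⟩

theorem sq_lintegral_le_of_sq_le {X : Type*} [MeasurableSpace X] {μ : Measure X}
    {f F G : X → ℝ≥0∞} (hF : AEMeasurable F μ) (hG : AEMeasurable G μ)
    (h : ∀ x, f x ^ 2 ≤ F x * G x) : (∫⁻ x, f x ∂μ) ^ 2 ≤ (∫⁻ x, F x ∂μ) * ∫⁻ x, G x ∂μ := by
  have hhalf : ∀ a : ℝ≥0∞, (a ^ (1 / 2 : ℝ)) ^ 2 = a := fun a => by
    rw [← ENNReal.rpow_natCast, ← ENNReal.rpow_mul]; norm_num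
  have h2 : ∀ a : ℝ≥0∞, (a ^ (1 / 2 : ℝ)) ^ (2 : ℝ) = a := fun a => by
    rw [← ENNReal.rpow_mul]; norm_num
  have hle : ∀ x, f x ≤ F x ^ (1 / 2 : ℝ) * G x ^ (1 / 2 : ℝ) := fun x => by
    rw [← ENNReal.mul_rpow_of_nonneg _ _ (by norm_num)]
    calc f x = (f x ^ 2) ^ (1 / 2 : ℝ) := by
          rw [← ENNReal.rpow_natCast, ← ENNReal.rpow_mul]; norm_num
      _ ≤ _ := ENNReal.rpow_le_rpow (h x) (by norm_num)
  have := (lintegral_mono hle).trans (ENNReal.lintegral_mul_le_Lp_mul_Lq μ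
    (p := 2) (q := 2) (by constructor <;> norm_num) (hF.pow_const (1 / 2))
    (hG.pow_const (1 / 2)))
  simp_rw [h2] at this
  calc _ ≤ _ := pow_le_pow_left' this 2
    _ = _ := by rw [mul_pow, hhalf, hhalf]

theorem lintegral_fin_four {E : Type*} [MeasureSpace E] [SigmaFinite (volume : Measure E)]
    {f : (Fin 4 → E) → ℝ≥0∞} (hf : Measurable f) :
    ∫⁻ v, f v = ∫⁻ a, ∫⁻ b, ∫⁻ c, ∫⁻ d, f ![a, b, c, d] := by
  have peel : ∀ (n : ℕ) (g : (Fin (n + 1) → E) → ℝ≥0∞), Measurable g →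
      ∫⁻ v, g v = ∫⁻ a, ∫⁻ w : Fin n → E, g (Fin.cons a w) := by
    intro n g hg
    rw [← ((volume_preserving_piFinSuccAbove (fun _ : Fin (n + 1) => E) 0).symm).lintegral_comp hg,
      Measure.volume_eq_prod, lintegral_prod _ (by
        exact (hg.comp (MeasurableEquiv.measurable _)).aemeasurable)]
    refine lintegral_congr fun a => lintegral_congr fun w => ?_
    congr 1
    simp [MeasurableEquiv.piFinSuccAbove, Fin.insertNthEquiv]
  rw [peel 3 f hf]
  refine lintegral_congr fun a => ?_
  have hc : ∀ {n : ℕ} (a : E), Measurable fun w : Fin n → E => (Fin.cons a w : Fin (n + 1) → E) := by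
    intro n a
    refine measurable_pi_iff.2 fun i => ?_
    refine Fin.cases ?_ (fun j => ?_) i
    · simp
    · simpa using measurable_pi_apply j
  refine (peel 2 (fun w => f (Fin.cons a w)) (hf.comp (hc a))).trans ?_
  refine lintegral_congr fun b => ?_
  refine (peel 1 (fun w => f (Fin.cons a (Fin.cons b w)))
    ((hf.comp (hc a)).comp (hc b))).trans ?_
  refine lintegral_congr fun c => ?_
  refine (peel 0 (fun w => f (Fin.cons a (Fin.cons b (Fin.cons c w))))
    (((hf.comp (hc a)).comp (hc b)).comp (hc c))).trans ?_
  refine lintegral_congr fun d => ?_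
  rw [volume_pi, Measure.pi_of_empty _ ![], lintegral_dirac]
  rfl

theorem lintegral_comp_perm {E : Type*} [MeasureSpace E] [SigmaFinite (volume : Measure E)]
    {ι : Type*} [Fintype ι] (e : Equiv.Perm ι) (f : (ι → E) → ℝ≥0∞) :
    ∫⁻ v : ι → E, f (fun i => v (e i)) = ∫⁻ v, f v := by
  have := (volume_measurePreserving_piCongrLeft (fun _ : ι => E) e.symm).lintegral_comp_emb
    (MeasurableEquiv.measurableEmbedding _) f
  rw [← this]
  refine lintegral_congr fun v => ?_
  congr 1
  funext i
  obtain ⟨j, rfl⟩ := e.symm.surjective i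
  rw [MeasurableEquiv.piCongrLeft_apply_apply]
  simp

/-- The frequency part of the multiplier. -/
def freqWeight (κ : ℝ) (v : Fin 4 → ℝ) : ℝ :=
  |∑ i, v i| * (1 + |∑ i, v i|) ^ (-κ) * ∏ i, (1 + |v i|) ^ κ

theorem mul_one_add_rpow_neg_mono {κ t T : ℝ} (hκ : κ ≤ 1 / 2) (ht : 0 ≤ t)
    (h : t ≤ T) : t * (1 + t) ^ (-(2 * κ)) ≤ T * (1 + T) ^ (-(2 * κ)) := by
  have e : ∀ x : ℝ, 0 ≤ x → x * (1 + x) ^ (-(2 * κ)) = (x / (1 + x)) * (1 + x) ^ (1 - 2 * κ) := by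
    intro x hx
    have : 0 < 1 + x := by linarith
    rw [show 1 - 2 * κ = 1 + -(2 * κ) by ring, Real.rpow_add this, Real.rpow_one]
    field_simp
  rw [e t ht, e T (ht.trans h)]
  have h1 : t / (1 + t) ≤ T / (1 + T) := by
    rw [div_le_div_iff₀ (by linarith) (by linarith)]; nlinarith
  have h2 : (1 + t) ^ (1 - 2 * κ) ≤ (1 + T) ^ (1 - 2 * κ) :=
    Real.rpow_le_rpow (by linarith) (by linarith) (by linarith)
  have h3 : 0 ≤ T / (1 + T) := div_nonneg (by linarith) (by linarith)
  gcongr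

theorem freqWeight_sq_le {κ : ℝ} (hκ0 : 0 ≤ κ) (hκ : κ ≤ 1 / 2) {v : Fin 4 → ℝ} {T R : ℝ}
    (hT : |∑ i, v i| ≤ T) (hR : ∀ i, |v i| ≤ R) :
    freqWeight κ v ^ 2 ≤
      |∑ i, v i| * (T * (1 + T) ^ (-(2 * κ))) * (1 + R) ^ (8 * κ) := by
  set S := |∑ i, v i| with hS
  have hS0 : 0 ≤ S := abs_nonneg _
  have hR0 : 0 ≤ R := (abs_nonneg _).trans (hR 0)
  have h1 : ∏ i, (1 + |v i|) ^ κ ≤ (1 + R) ^ (4 * κ) := by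
    calc ∏ i, (1 + |v i|) ^ κ ≤ ∏ _i : Fin 4, (1 + R) ^ κ := by
          refine Finset.prod_le_prod (fun i _ => by positivity) fun i _ => ?_
          exact Real.rpow_le_rpow (by positivity) (by linarith [hR i]) hκ0
      _ = (1 + R) ^ (4 * κ) := by
          rw [Finset.prod_const, Finset.card_fin, ← Real.rpow_natCast, ← Real.rpow_mul (by linarith)]
          congr 1; push_cast; ring
  have h0 : 0 ≤ ∏ i, (1 + |v i|) ^ κ := Finset.prod_nonneg fun i _ => by positivity
  have h2 : ((1 + S) ^ (-κ)) ^ 2 = (1 + S) ^ (-(2 * κ)) := by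
    rw [← Real.rpow_natCast, ← Real.rpow_mul (by linarith)]; congr 1; push_cast; ring
  have h3 : ((1 + R) ^ (4 * κ)) ^ 2 = (1 + R) ^ (8 * κ) := by
    rw [← Real.rpow_natCast, ← Real.rpow_mul (by linarith)]; congr 1; push_cast; ring
  have h4 := mul_one_add_rpow_neg_mono hκ hS0 hT
  calc freqWeight κ v ^ 2 = S * (S * (1 + S) ^ (-(2 * κ))) * (∏ i, (1 + |v i|) ^ κ) ^ 2 := by
        rw [freqWeight, ← hS, ← h2]; ring
    _ ≤ S * (T * (1 + T) ^ (-(2 * κ))) * ((1 + R) ^ (4 * κ)) ^ 2 := by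
        have : 0 ≤ S * (1 + S) ^ (-(2 * κ)) := by positivity
        have : 0 ≤ T * (1 + T) ^ (-(2 * κ)) := this.trans h4
        gcongr
    _ = _ := by rw [h3]

theorem freqWeight_sq_le_of_bilinearRegion {κ : ℝ} (hκ0 : 0 ≤ κ) (hκ : κ ≤ 1 / 2) {v : Fin 4 → ℝ}
    (h : BilinearRegion (v 0) (v 1) (v 2) (v 3)) :
    freqWeight κ v ^ 2 ≤ |v 0 ^ 2 - v 1 ^ 2| * (400 * (1 + |v 0|) ^ (6 * κ)) := by
  obtain ⟨⟨hb, hab⟩, ⟨hx, hy⟩, -⟩ := h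
  have hR : ∀ i, |v i| ≤ |v 0| := by
    intro i; fin_cases i
    · exact le_rfl
    · exact hb
    · exact hx
    · exact hy
  have hT : |∑ i, v i| ≤ 4 * |v 0| := by
    refine (Finset.abs_sum_le_sum_abs _ _).trans ?_
    refine (Finset.sum_le_sum fun i _ => hR i).trans ?_
    simp
  rw [← Fin.sum_univ_four] at hab
  have h0 := abs_nonneg (v 0)
  have hS0 := abs_nonneg (∑ i, v i)
  refine (freqWeight_sq_le hκ0 hκ hT hR).trans ?_
  have h1 : (1 + 4 * |v 0|) ^ (-(2 * κ)) ≤ (1 + |v 0|) ^ (-(2 * κ)) :=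
    Real.rpow_le_rpow_of_nonpos (by positivity) (by linarith) (by linarith)
  have h2 : (1 + |v 0|) ^ (-(2 * κ)) * (1 + |v 0|) ^ (8 * κ) = (1 + |v 0|) ^ (6 * κ) := by
    rw [← Real.rpow_add (by positivity)]; congr 1; ring
  calc |∑ i, v i| * (4 * |v 0| * (1 + 4 * |v 0|) ^ (-(2 * κ))) * (1 + |v 0|) ^ (8 * κ)
      ≤ |∑ i, v i| * (4 * |v 0| * (1 + |v 0|) ^ (-(2 * κ))) * (1 + |v 0|) ^ (8 * κ) := by gcongr
    _ = 4 * (|v 0| * |∑ i, v i|) * (1 + |v 0|) ^ (6 * κ) := by rw [← h2]; ring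
    _ ≤ 4 * (100 * |v 0 ^ 2 - v 1 ^ 2|) * (1 + |v 0|) ^ (6 * κ) := by gcongr
    _ = _ := by ring

theorem freqWeight_sq_le_of_trilinearRegion {κ : ℝ} (hκ0 : 0 ≤ κ) (hκ : κ ≤ 1 / 2)
    {v : Fin 4 → ℝ} (h : TrilinearRegion (v 0) (v 1) (v 2) (v 3)) :
    freqWeight κ v ^ 2 ≤
      |v 0 + v 1 + v 2| * (144 * |v 0 + v 1 + v 2| * (1 + |v 0 + v 1 + v 2|) ^ (6 * κ)) := by
  obtain ⟨⟨hx, hy⟩, hk, -⟩ := h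
  set m := v 0 + v 1 + v 2 with hm
  have h0 := abs_nonneg m
  have hm' := abs_le.1 (le_refl |m|)
  have hR : ∀ i, |v i| ≤ 2 * |m| := by
    rw [abs_le] at hx hy
    intro i; fin_cases i
    · exact abs_le.2 ⟨by simp only [Fin.zero_eta]; linarith, by simp only [Fin.zero_eta]; linarith⟩
    · exact abs_le.2 ⟨by simp only [Fin.mk_one]; linarith, by simp only [Fin.mk_one]; linarith⟩
    · change |v 2| ≤ _
      exact abs_le.2 ⟨by linarith, by linarith⟩
    · exact hk
  have hT : |∑ i, v i| ≤ 3 * |m| := by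
    rw [Fin.sum_univ_four, ← hm]
    exact (abs_add_le _ _).trans (by linarith)
  have hS0 := abs_nonneg (∑ i, v i)
  refine (freqWeight_sq_le hκ0 hκ hT hR).trans ?_
  have h1 : (1 + 3 * |m|) ^ (-(2 * κ)) ≤ (1 + |m|) ^ (-(2 * κ)) :=
    Real.rpow_le_rpow_of_nonpos (by positivity) (by linarith) (by linarith)
  have h2 : (1 + |m|) ^ (-(2 * κ)) * (1 + |m|) ^ (8 * κ) = (1 + |m|) ^ (6 * κ) := by
    rw [← Real.rpow_add (by positivity)]; congr 1; ring
  have h3 : (1 + 2 * |m|) ^ (8 * κ) ≤ 16 * (1 + |m|) ^ (8 * κ) := by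
    calc (1 + 2 * |m|) ^ (8 * κ) ≤ (2 * (1 + |m|)) ^ (8 * κ) :=
          Real.rpow_le_rpow (by positivity) (by linarith) (by linarith)
      _ = 2 ^ (8 * κ) * (1 + |m|) ^ (8 * κ) := Real.mul_rpow (by norm_num) (by positivity)
      _ ≤ 2 ^ (4 : ℝ) * (1 + |m|) ^ (8 * κ) := by
          gcongr
          · norm_num
          · linarith
      _ = _ := by norm_num
  calc |∑ i, v i| * (3 * |m| * (1 + 3 * |m|) ^ (-(2 * κ))) * (1 + 2 * |m|) ^ (8 * κ)
      ≤ (3 * |m|) * (3 * |m| * (1 + |m|) ^ (-(2 * κ))) * (16 * (1 + |m|) ^ (8 * κ)) := by gcongr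
    _ = |m| * (144 * |m| * (1 + |m|) ^ (6 * κ)) := by rw [← h2]; ring

/-- The multilinear form at fixed modulations. -/
def sliceIntegrand (κ α Λ : ℝ) (H : ℝ × ℝ → ℝ≥0∞) (g : Fin 4 → ℝ → ℝ≥0∞) (v : Fin 4 → ℝ) :
    ℝ≥0∞ :=
  H (Λ + ∑ i, v i ^ 3, ∑ i, v i) * (ENNReal.ofReal (freqWeight κ v) *
    ENNReal.ofReal (1 + |Λ + ∑ i, v i ^ 3 - (∑ i, v i) ^ 3|) ^ (-(α / 2))) * ∏ i, g i (v i)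

theorem measurableSet_bilinearRegion :
    MeasurableSet {v : Fin 4 → ℝ | BilinearRegion (v 0) (v 1) (v 2) (v 3)} := by
  unfold BilinearRegion
  refine measurableSet_setOf_and (measurableSet_le_and_le ?_ ?_ ?_ ?_) (measurableSet_setOf_and
    (measurableSet_le_and_le ?_ ?_ ?_ ?_) (measurableSet_setOf_or (measurableSet_le ?_ ?_)
    (measurableSet_setOf_or (measurableSet_le ?_ ?_) (measurableSet_le ?_ ?_)))) <;> fun_prop

theorem measurableSet_trilinearRegion :
    MeasurableSet {v : Fin 4 → ℝ | TrilinearRegion (v 0) (v 1) (v 2) (v 3)} := by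
  unfold TrilinearRegion
  refine measurableSet_setOf_and (measurableSet_le_and_le ?_ ?_ ?_ ?_)
    (measurableSet_le_and_le ?_ ?_ ?_ ?_) <;> fun_prop

theorem measurable_sliceIntegrand (κ α Λ : ℝ) {H : ℝ × ℝ → ℝ≥0∞} {g : Fin 4 → ℝ → ℝ≥0∞}
    (hH : Measurable H) (hg : ∀ i, Measurable (g i)) :
    Measurable (sliceIntegrand κ α Λ H g) := by
  unfold sliceIntegrand freqWeight
  fun_prop

theorem sliceIntegrand_sq_le {κ α Λ : ℝ} {H : ℝ × ℝ → ℝ≥0∞} {g : Fin 4 → ℝ → ℝ≥0∞}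
    {v : Fin 4 → ℝ} {P Q : ℝ} (hP : 0 ≤ P) (h : freqWeight κ v ^ 2 ≤ P * Q) :
    sliceIntegrand κ α Λ H g v ^ 2 ≤ H (Λ + ∑ i, v i ^ 3, ∑ i, v i) ^ 2 *
      (ENNReal.ofReal P * ENNReal.ofReal Q *
        ENNReal.ofReal (1 + |Λ + ∑ i, v i ^ 3 - (∑ i, v i) ^ 3|) ^ (-α)) * ∏ i, g i (v i) ^ 2 := by
  rw [sliceIntegrand, mul_pow, mul_pow, mul_pow, ← Finset.prod_pow, ← ENNReal.ofReal_mul hP]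
  have h0 : 0 ≤ freqWeight κ v := by
    unfold freqWeight
    have : 0 ≤ ∏ i, (1 + |v i|) ^ κ := Finset.prod_nonneg fun i _ => by positivity
    positivity
  have h1 : (ENNReal.ofReal (1 + |Λ + ∑ i, v i ^ 3 - (∑ i, v i) ^ 3|) ^ (-(α / 2))) ^ 2 =
      ENNReal.ofReal (1 + |Λ + ∑ i, v i ^ 3 - (∑ i, v i) ^ 3|) ^ (-α) := by
    rw [← ENNReal.rpow_natCast, ← ENNReal.rpow_mul]; congr 1; push_cast; ring
  rw [h1, ← ENNReal.ofReal_pow h0]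
  gcongr

theorem lintegral_lintegral_const_mul {f : ℝ → ℝ → ℝ≥0∞} (k : ℝ≥0∞)
    (hf : Measurable (Function.uncurry f)) :
    ∫⁻ x, ∫⁻ y, k * f x y = k * ∫⁻ x, ∫⁻ y, f x y := by
  have h : Measurable fun x => ∫⁻ y, f x y := hf.lintegral_prod_right
  rw [← lintegral_const_mul _ h]
  exact lintegral_congr fun x => lintegral_const_mul _ (hf.comp measurable_prodMk_left)

theorem lintegral_lintegral_mul_mul {f g : ℝ → ℝ≥0∞} (hf : Measurable f) (hg : Measurable g)
    (k : ℝ≥0∞) : ∫⁻ x, ∫⁻ y, f x * g y * k = (∫⁻ x, f x) * (∫⁻ y, g y) * k := by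
  rw [mul_assoc, ← lintegral_mul_const _ hg, ← lintegral_mul_const _ hf]
  refine lintegral_congr fun x => ?_
  rw [← lintegral_const_mul _ (hg.mul_const k)]
  exact lintegral_congr fun y => mul_assoc _ _ _

theorem exists_sq_setLIntegral_bilinearRegion_le {α κ : ℝ} (hα0 : 0 < α) (hα : α < 1) (hκ0 : 0 ≤ κ)
    (hκ : 6 * κ ≤ 3 * α - 2) :
    ∃ C : ℝ≥0∞, C ≠ ⊤ ∧ ∀ (Λ : ℝ) (H : ℝ × ℝ → ℝ≥0∞) (g : Fin 4 → ℝ → ℝ≥0∞), Measurable H →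
      (∀ i, Measurable (g i)) →
      (∫⁻ v, {v : Fin 4 → ℝ | BilinearRegion (v 0) (v 1) (v 2) (v 3)}.indicator
        (sliceIntegrand κ α Λ H g) v) ^ 2 ≤ C * ((∫⁻ p, H p ^ 2) * ∏ i, ∫⁻ x, g i x ^ 2) := by
  obtain ⟨C, hC, hres⟩ := exists_lintegral_resonance_le (δ := 1 / 100) hα0 hα
    (by linarith : 0 ≤ 6 * κ) hκ (by norm_num)
  refine ⟨ENNReal.ofReal 400 * C, by finiteness, fun Λ H g hH hg => ?_⟩
  set S : Set (Fin 4 → ℝ) := {v | (|v 2| ≤ |v 0| ∧ |v 3| ≤ |v 0|) ∧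
    (1 / 100 * |v 0| ≤ |2 * v 2 + v 3 + (v 0 + v 1)| ∨
      1 / 100 * |v 0| ≤ |2 * v 3 + v 2 + (v 0 + v 1)| ∨ 1 / 100 * |v 0| ≤ |v 2 - v 3|)} with hS
  have hSm : MeasurableSet S := by
    refine measurableSet_setOf_and
      (measurableSet_le_and_le ?_ ?_ ?_ ?_) (measurableSet_setOf_or (measurableSet_le ?_ ?_)
      (measurableSet_setOf_or (measurableSet_le ?_ ?_) (measurableSet_le ?_ ?_))) <;> fun_prop
  set F : (Fin 4 → ℝ) → ℝ≥0∞ := fun v => g 2 (v 2) ^ 2 * (g 3 (v 3) ^ 2 *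
    (ENNReal.ofReal |v 0 ^ 2 - v 1 ^ 2| * H (Λ + ∑ i, v i ^ 3, ∑ i, v i) ^ 2)) with hF
  set B : (Fin 4 → ℝ) → ℝ≥0∞ := fun v =>
    ENNReal.ofReal (1 + |Λ + ∑ i, v i ^ 3 - (∑ i, v i) ^ 3|) ^ (-α) with hB
  set G : (Fin 4 → ℝ) → ℝ≥0∞ := fun v => g 0 (v 0) ^ 2 * (g 1 (v 1) ^ 2 *
    (ENNReal.ofReal (400 * (1 + |v 0|) ^ (6 * κ)) * S.indicator B v)) with hG
  have hBm : Measurable (S.indicator B) := by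
    refine Measurable.indicator ?_ hSm
    fun_prop
  have hFm : Measurable F := by fun_prop
  have hGm : Measurable G := by fun_prop
  refine (sq_lintegral_le_of_sq_le hFm.aemeasurable hGm.aemeasurable fun v => ?_).trans
    (b := (∫⁻ v, F v) * ∫⁻ v, G v) ?_
  · by_cases hv : BilinearRegion (v 0) (v 1) (v 2) (v 3)
    · rw [indicator_of_mem (by exact hv)]
      refine (sliceIntegrand_sq_le (abs_nonneg _)
        (freqWeight_sq_le_of_bilinearRegion hκ0 (by linarith) hv)).trans_eq ?_
      have hSv : S.indicator B v = B v := indicator_of_mem (show v ∈ S from hv.2) _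
      rw [Fin.prod_univ_four]
      simp only [hF, hG, hSv]
      simp only [hB]
      ring
    · rw [indicator_of_notMem (by exact hv)]
      simp
  have hFle : ∫⁻ v, F v ≤ (∫⁻ x, g 2 x ^ 2) * (∫⁻ x, g 3 x ^ 2) * ∫⁻ p, H p ^ 2 := by
    rw [← lintegral_comp_perm ((Equiv.swap 0 2).trans (Equiv.swap 1 3)),
      lintegral_fin_four (by fun_prop),
      ← lintegral_lintegral_mul_mul ((hg 2).pow_const 2) ((hg 3).pow_const 2)]
    refine lintegral_mono fun a => lintegral_mono fun b => ?_
    have e : ∀ c d : ℝ, F (fun i => ![a, b, c, d]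
        (((Equiv.swap 0 2).trans (Equiv.swap 1 3)) i)) = g 2 a ^ 2 * g 3 b ^ 2 *
        (ENNReal.ofReal |c ^ 2 - d ^ 2| *
          H ((Λ + a ^ 3 + b ^ 3) + c ^ 3 + d ^ 3, (a + b) + c + d) ^ 2) := by
      intro c d
      have : (fun i => ![a, b, c, d] (((Equiv.swap 0 2).trans (Equiv.swap 1 3)) i)) =
          ![c, d, a, b] := by
        funext i; fin_cases i <;> rfl
      rw [this]
      simp only [hF, Fin.sum_univ_four]
      simp only [Matrix.cons_val]
      ring_nf
    simp_rw [e]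
    rw [lintegral_lintegral_const_mul _ (by fun_prop)]
    exact mul_le_mul' le_rfl (lintegral_bilinear_le _ _ (hH.pow_const 2))
  have hGle : ∫⁻ v, G v ≤ (∫⁻ x, g 0 x ^ 2) * (∫⁻ x, g 1 x ^ 2) * (ENNReal.ofReal 400 * C) := by
    rw [lintegral_fin_four hGm,
      ← lintegral_lintegral_mul_mul ((hg 0).pow_const 2) ((hg 1).pow_const 2)]
    refine lintegral_mono fun a => lintegral_mono fun b => ?_
    have hSB : ∀ c d, S.indicator B ![a, b, c, d] =
        {p : ℝ × ℝ | (|p.1| ≤ |a| ∧ |p.2| ≤ |a|) ∧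
        (1 / 100 * |a| ≤ |2 * p.1 + p.2 + (a + b)| ∨ 1 / 100 * |a| ≤ |2 * p.2 + p.1 + (a + b)| ∨
          1 / 100 * |a| ≤ |p.1 - p.2|)}.indicator (fun p =>
        ENNReal.ofReal (1 + |Λ + a ^ 3 + b ^ 3 - (a + b) ^ 3 -
          3 * ((p.1 + p.2) * (p.1 + (a + b)) * (p.2 + (a + b)))|) ^ (-α)) (c, d) := by
      intro c d
      have hph : Λ + (a ^ 3 + b ^ 3 + c ^ 3 + d ^ 3) - (a + b + c + d) ^ 3 =
          Λ + a ^ 3 + b ^ 3 - (a + b) ^ 3 - 3 * ((c + d) * (c + (a + b)) * (d + (a + b))) := by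
        ring
      simp only [hB, hS, indicator, mem_ofPred_eq, Fin.sum_univ_four, Matrix.cons_val, hph]
    have hm : Measurable (Function.uncurry fun c d => S.indicator B ![a, b, c, d]) := by
      refine hBm.comp (measurable_pi_iff.2 fun i => ?_)
      fin_cases i <;> simp <;> fun_prop
    have e : ∀ c d : ℝ, G ![a, b, c, d] = (g 0 a ^ 2 * g 1 b ^ 2 *
        ENNReal.ofReal (400 * (1 + |a|) ^ (6 * κ))) * S.indicator B ![a, b, c, d] := by
      intro c d
      simp only [hG, Matrix.cons_val, mul_assoc]
    simp_rw [e]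
    rw [lintegral_lintegral_const_mul _ hm]
    simp_rw [hSB]
    refine (mul_le_mul' le_rfl (hres |a| (abs_nonneg a) (Λ + a ^ 3 + b ^ 3 - (a + b) ^ 3)
      (a + b))).trans_eq ?_
    have h1 : ENNReal.ofReal (1 + |a|) ^ (6 * κ) * ENNReal.ofReal (1 + |a|) ^ (-(6 * κ)) = 1 := by
      rw [← ENNReal.rpow_add _ _ (by simp; positivity) ENNReal.ofReal_ne_top]; simp
    rw [ENNReal.ofReal_mul (by norm_num), ← ENNReal.ofReal_rpow_of_pos (by positivity)]
    calc _ = g 0 a ^ 2 * g 1 b ^ 2 * (ENNReal.ofReal 400 * C) * (ENNReal.ofReal (1 + |a|) ^ (6 * κ)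
        * ENNReal.ofReal (1 + |a|) ^ (-(6 * κ))) := by ring
      _ = _ := by rw [h1, mul_one]
  refine (mul_le_mul' hFle hGle).trans_eq ?_
  rw [Fin.prod_univ_four]
  ring

theorem lintegral_lintegral_lintegral_const_mul {f : ℝ → ℝ → ℝ → ℝ≥0∞} (k : ℝ≥0∞)
    (hf : Measurable fun p : ℝ × ℝ × ℝ => f p.1 p.2.1 p.2.2) :
    ∫⁻ x, ∫⁻ y, ∫⁻ z, k * f x y z = k * ∫⁻ x, ∫⁻ y, ∫⁻ z, f x y z := by
  have h1 : Measurable fun q : (ℝ × ℝ) × ℝ => f q.1.1 q.1.2 q.2 :=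
    hf.comp (g := fun p : ℝ × ℝ × ℝ => f p.1 p.2.1 p.2.2)
      (f := fun q : (ℝ × ℝ) × ℝ => (q.1.1, q.1.2, q.2)) (by fun_prop)
  have h2 : Measurable (Function.uncurry fun x y => ∫⁻ z, f x y z) := h1.lintegral_prod_right'
  rw [← lintegral_lintegral_const_mul k h2]
  exact lintegral_congr fun x => lintegral_congr fun y => lintegral_const_mul k <|
    h1.comp (measurable_prodMk_left (x := (x, y)))

theorem lintegral_lintegral_lintegral_mul_mul {f g h : ℝ → ℝ≥0∞} (hf : Measurable f)
    (hg : Measurable g) (hh : Measurable h) (k : ℝ≥0∞) :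
    ∫⁻ x, ∫⁻ y, ∫⁻ z, f x * g y * h z * k =
      (∫⁻ x, f x) * (∫⁻ y, g y) * (∫⁻ z, h z) * k := by
  have e : ∀ x, ∫⁻ y, ∫⁻ z, f x * g y * h z * k = f x * (∫⁻ y, g y) * (∫⁻ z, h z) * k := fun x => by
    rw [lintegral_lintegral_mul_mul (hg.const_mul (f x)) hh k, lintegral_const_mul (f x) hg]
  simp_rw [e]
  rw [lintegral_mul_const _ ((hf.mul_const _).mul_const _),
    lintegral_mul_const _ (hf.mul_const _), lintegral_mul_const _ hf]

theorem exists_sq_setLIntegral_trilinearRegion_le {α κ : ℝ} (hα0 : 0 < α) (hα : α < 1)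
    (hκ0 : 0 ≤ κ) (hκ : 6 * κ ≤ 3 * α - 2) :
    ∃ C : ℝ≥0∞, C ≠ ⊤ ∧ ∀ (Λ : ℝ) (H : ℝ × ℝ → ℝ≥0∞) (g : Fin 4 → ℝ → ℝ≥0∞), Measurable H →
      (∀ i, Measurable (g i)) →
      (∫⁻ v, {v : Fin 4 → ℝ | TrilinearRegion (v 0) (v 1) (v 2) (v 3)}.indicator
        (sliceIntegrand κ α Λ H g) v) ^ 2 ≤ C * ((∫⁻ p, H p ^ 2) * ∏ i, ∫⁻ x, g i x ^ 2) := by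
  obtain ⟨C, hC, hres⟩ := exists_lintegral_quadratic_resonance_le hα0 hα
    (by linarith : 0 ≤ 6 * κ) hκ
  refine ⟨8 * (ENNReal.ofReal 144 * C), by finiteness, fun Λ H g hH hg => ?_⟩
  set m : (Fin 4 → ℝ) → ℝ := fun v => v 0 + v 1 + v 2 with hm
  set S : Set (Fin 4 → ℝ) := {v | |v 0 - m v / 3| ≤ |m v| / 9 ∧ |v 1 - m v / 3| ≤ |m v| / 9} with hS
  set T : Set (Fin 4 → ℝ) := {v | |v 3| ≤ 2 * |m v| ∧ |m v| / 9 ≤ |2 * v 3 + m v|} with hT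
  have hSm : MeasurableSet S := measurableSet_le_and_le (by fun_prop) (by fun_prop) (by fun_prop)
    (by fun_prop)
  have hTm : MeasurableSet T := measurableSet_le_and_le (by fun_prop) (by fun_prop) (by fun_prop)
    (by fun_prop)
  set A : (Fin 4 → ℝ) → ℝ≥0∞ := fun v =>
    ENNReal.ofReal |m v| * H (Λ + ∑ i, v i ^ 3, ∑ i, v i) ^ 2 with hA
  set B : (Fin 4 → ℝ) → ℝ≥0∞ := fun v =>
    ENNReal.ofReal (1 + |Λ + ∑ i, v i ^ 3 - (∑ i, v i) ^ 3|) ^ (-α) with hB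
  set F : (Fin 4 → ℝ) → ℝ≥0∞ := fun v => g 3 (v 3) ^ 2 * S.indicator A v with hF
  set G : (Fin 4 → ℝ) → ℝ≥0∞ := fun v => g 0 (v 0) ^ 2 * g 1 (v 1) ^ 2 * g 2 (v 2) ^ 2 *
    ENNReal.ofReal (144 * |m v| * (1 + |m v|) ^ (6 * κ)) * T.indicator B v with hG
  have hAm : Measurable (S.indicator A) := Measurable.indicator (by fun_prop) hSm
  have hBm : Measurable (T.indicator B) := Measurable.indicator (by fun_prop) hTm
  have hFm : Measurable F := by fun_prop
  have hGm : Measurable G := by fun_prop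
  refine (sq_lintegral_le_of_sq_le hFm.aemeasurable hGm.aemeasurable fun v => ?_).trans
    (b := (∫⁻ v, F v) * ∫⁻ v, G v) ?_
  · by_cases hv : TrilinearRegion (v 0) (v 1) (v 2) (v 3)
    · rw [indicator_of_mem (by exact hv)]
      refine (sliceIntegrand_sq_le (abs_nonneg _)
        (freqWeight_sq_le_of_trilinearRegion hκ0 (by linarith) hv)).trans_eq ?_
      have hSv : S.indicator A v = A v := indicator_of_mem (show v ∈ S from hv.1) _
      have hTv : T.indicator B v = B v := indicator_of_mem (show v ∈ T from hv.2) _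
      rw [Fin.prod_univ_four]
      simp only [hF, hG, hSv, hTv]
      simp only [hA, hB, hm]
      ring
    · rw [indicator_of_notMem (by exact hv)]
      simp
  have hFle : ∫⁻ v, F v ≤ (∫⁻ x, g 3 x ^ 2) * (8 * ∫⁻ p, H p ^ 2) := by
    rw [← lintegral_comp_perm (finRotate 4), lintegral_fin_four (by fun_prop),
      ← lintegral_mul_const _ ((hg 3).pow_const 2)]
    refine lintegral_mono fun k => ?_
    have hSA : ∀ x y z : ℝ, S.indicator A ![x, y, z, k] =
        {m : ℝ | |x - m / 3| ≤ |m| / 9 ∧ |y - m / 3| ≤ |m| / 9}.indicator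
        (fun m => ENNReal.ofReal |m| *
          H ((Λ + k ^ 3) + x ^ 3 + y ^ 3 + z ^ 3, k + m) ^ 2) (x + y + z) := by
      intro x y z
      have e1 : Λ + (x ^ 3 + y ^ 3 + z ^ 3 + k ^ 3) = (Λ + k ^ 3) + x ^ 3 + y ^ 3 + z ^ 3 := by ring
      simp only [hA, hS, hm, indicator, mem_ofPred_eq, Fin.sum_univ_four, Matrix.cons_val, e1,
        add_comm k]
    have hm : Measurable fun p : ℝ × ℝ × ℝ => S.indicator A ![p.1, p.2.1, p.2.2, k] := by
      refine hAm.comp (measurable_pi_iff.2 fun i => ?_)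
      fin_cases i <;> simp <;> fun_prop
    have e : ∀ x y z : ℝ, F (fun i => ![k, x, y, z] (finRotate 4 i)) =
        g 3 k ^ 2 * S.indicator A ![x, y, z, k] := by
      intro x y z
      have : (fun i => ![k, x, y, z] (finRotate 4 i)) = ![x, y, z, k] := by
        funext i; fin_cases i <;> rfl
      rw [this]
      simp only [hF, Matrix.cons_val]
    simp_rw [e]
    rw [lintegral_lintegral_lintegral_const_mul _ hm]
    simp_rw [hSA]
    exact mul_le_mul' le_rfl (lintegral_trilinear_le _ _ (F := fun p => H p ^ 2) (hH.pow_const 2))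
  have hGle : ∫⁻ v, G v ≤
      (∫⁻ x, g 0 x ^ 2) * (∫⁻ x, g 1 x ^ 2) * (∫⁻ x, g 2 x ^ 2) * (ENNReal.ofReal 144 * C) := by
    rw [lintegral_fin_four hGm, ← lintegral_lintegral_lintegral_mul_mul ((hg 0).pow_const 2)
      ((hg 1).pow_const 2) ((hg 2).pow_const 2)]
    refine lintegral_mono fun x => lintegral_mono fun y => lintegral_mono fun z => ?_
    set n := x + y + z with hn
    have hTB : ∀ k, T.indicator B ![x, y, z, k] =
        {k : ℝ | |k| ≤ 2 * |n| ∧ |n| / 9 ≤ |2 * k + n|}.indicator (fun k =>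
        ENNReal.ofReal (1 + |Λ + x ^ 3 + y ^ 3 + z ^ 3 - n ^ 3 -
          3 * n * (k ^ 2 + n * k)|) ^ (-α)) k := by
      intro k
      have hph : Λ + (x ^ 3 + y ^ 3 + z ^ 3 + k ^ 3) - (n + k) ^ 3 =
          Λ + x ^ 3 + y ^ 3 + z ^ 3 - n ^ 3 - 3 * n * (k ^ 2 + n * k) := by
        ring
      simp only [hB, hT, hm, indicator, mem_ofPred_eq, Fin.sum_univ_four, Matrix.cons_val, ← hn,
        hph]
    have e : ∀ k : ℝ, G ![x, y, z, k] = (g 0 x ^ 2 * g 1 y ^ 2 * g 2 z ^ 2 *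
        ENNReal.ofReal (144 * |n| * (1 + |n|) ^ (6 * κ))) * T.indicator B ![x, y, z, k] := by
      intro k
      simp only [hG, hm, Matrix.cons_val, ← hn]
    have hm1 : Measurable fun k => ENNReal.ofReal (1 + |Λ + x ^ 3 + y ^ 3 + z ^ 3 - n ^ 3 -
          3 * n * (k ^ 2 + n * k)|) ^ (-α) := by fun_prop
    have hm2 : MeasurableSet {k : ℝ | |k| ≤ 2 * |n| ∧ |n| / 9 ≤ |2 * k + n|} :=
      measurableSet_le_and_le (by fun_prop) (by fun_prop) (by fun_prop) (by fun_prop)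
    simp_rw [e, hTB]
    rw [lintegral_const_mul _ (hm1.indicator hm2), lintegral_indicator hm2]
    have h := hres (Λ + x ^ 3 + y ^ 3 + z ^ 3 - n ^ 3) n
    rw [lintegral_const_mul _ hm1] at h
    have h1 : ENNReal.ofReal (1 + |n|) ^ (6 * κ) * ENNReal.ofReal (1 + |n|) ^ (-(6 * κ)) = 1 := by
      rw [← ENNReal.rpow_add _ _ (by simp; positivity) ENNReal.ofReal_ne_top]; simp
    rw [ENNReal.ofReal_mul (by positivity), ENNReal.ofReal_mul (by norm_num),
      ← ENNReal.ofReal_rpow_of_pos (by positivity)]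
    calc _ = g 0 x ^ 2 * g 1 y ^ 2 * g 2 z ^ 2 *
            (ENNReal.ofReal 144 * ENNReal.ofReal (1 + |n|) ^ (6 * κ)) * _ := by
          rw [mul_right_comm (ENNReal.ofReal 144), ← mul_assoc _ _ (ENNReal.ofReal |n|),
            mul_assoc _ (ENNReal.ofReal |n|)]
      _ ≤ _ := mul_le_mul' le_rfl h
      _ = g 0 x ^ 2 * g 1 y ^ 2 * g 2 z ^ 2 * (ENNReal.ofReal 144 * C) *
          (ENNReal.ofReal (1 + |n|) ^ (6 * κ) * ENNReal.ofReal (1 + |n|) ^ (-(6 * κ))) := by ring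
      _ = _ := by rw [h1, mul_one]
  refine (mul_le_mul' hFle hGle).trans_eq ?_
  rw [Fin.prod_univ_four]
  ring

theorem sliceIntegrand_comp_perm (κ α Λ : ℝ) (H : ℝ × ℝ → ℝ≥0∞) (g : Fin 4 → ℝ → ℝ≥0∞)
    (e : Equiv.Perm (Fin 4)) (v : Fin 4 → ℝ) :
    sliceIntegrand κ α Λ H (fun i => g (e i)) (fun i => v (e i)) = sliceIntegrand κ α Λ H g v := by
  have h1 : ∑ i, v (e i) = ∑ i, v i := Equiv.sum_comp e v
  have h2 : ∑ i, v (e i) ^ 3 = ∑ i, v i ^ 3 := Equiv.sum_comp e fun i => v i ^ 3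
  have h3 : ∏ i, (1 + |v (e i)|) ^ κ = ∏ i, (1 + |v i|) ^ κ :=
    Equiv.prod_comp e fun i => (1 + |v i|) ^ κ
  have h4 : ∏ i, g (e i) (v (e i)) = ∏ i, g i (v i) := Equiv.prod_comp e fun i => g i (v i)
  simp only [sliceIntegrand, freqWeight, h1, h2, h3, h4]

theorem ennreal_le_rpow_half_of_sq_le {x y : ℝ≥0∞} (h : x ^ 2 ≤ y) : x ≤ y ^ (1 / 2 : ℝ) := by
  rw [one_div, ENNReal.le_rpow_inv_iff (by norm_num)]
  exact_mod_cast h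

theorem ennreal_rpow_half_sq (x : ℝ≥0∞) : (x ^ (1 / 2 : ℝ)) ^ 2 = x := by
  rw [← ENNReal.rpow_natCast, ← ENNReal.rpow_mul]; norm_num

theorem exists_sq_lintegral_sliceIntegrand_le {α κ : ℝ} (hα0 : 0 < α) (hα : α < 1)
    (hκ0 : 0 ≤ κ) (hκ : 6 * κ ≤ 3 * α - 2) :
    ∃ C : ℝ≥0∞, C ≠ ⊤ ∧ ∀ (Λ : ℝ) (H : ℝ × ℝ → ℝ≥0∞) (g : Fin 4 → ℝ → ℝ≥0∞), Measurable H →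
      (∀ i, Measurable (g i)) →
      (∫⁻ v, sliceIntegrand κ α Λ H g v) ^ 2 ≤ C * ((∫⁻ p, H p ^ 2) * ∏ i, ∫⁻ x, g i x ^ 2) := by
  obtain ⟨C₁, hC₁, h₁⟩ := exists_sq_setLIntegral_bilinearRegion_le hα0 hα hκ0 hκ
  obtain ⟨C₂, hC₂, h₂⟩ := exists_sq_setLIntegral_trilinearRegion_le hα0 hα hκ0 hκ
  refine ⟨48 ^ 2 * (C₁ + C₂), by finiteness, fun Λ H g hH hg => ?_⟩
  set M := (∫⁻ p, H p ^ 2) * ∏ i, ∫⁻ x, g i x ^ 2 with hM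
  set SB := {v : Fin 4 → ℝ | BilinearRegion (v 0) (v 1) (v 2) (v 3)} with hSB
  set ST := {v : Fin 4 → ℝ | TrilinearRegion (v 0) (v 1) (v 2) (v 3)} with hST
  set f : Equiv.Perm (Fin 4) → (Fin 4 → ℝ) → ℝ≥0∞ := fun e =>
    sliceIntegrand κ α Λ H fun i => g (e i) with hf
  have hfm : ∀ e, Measurable (f e) := fun e => measurable_sliceIntegrand _ _ _ hH fun i => hg _
  have hBm : ∀ e, Measurable (SB.indicator (f e)) := fun e =>
    (hfm e).indicator measurableSet_bilinearRegion
  have hTm : ∀ e, Measurable (ST.indicator (f e)) := fun e =>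
    (hfm e).indicator measurableSet_trilinearRegion
  have hpt : ∀ v, sliceIntegrand κ α Λ H g v ≤ ∑ e : Equiv.Perm (Fin 4),
      (SB.indicator (f e) (fun i => v (e i)) + ST.indicator (f e) (fun i => v (e i))) := by
    intro v
    obtain ⟨e, he⟩ := exists_perm_region v
    refine le_trans ?_ (Finset.single_le_sum (fun _ _ => bot_le) (Finset.mem_univ e))
    rw [← sliceIntegrand_comp_perm κ α Λ H g e v]
    rcases he with he | he
    · rw [indicator_of_mem (show (fun i => v (e i)) ∈ SB from he)]
      exact le_self_add
    · rw [indicator_of_mem (show (fun i => v (e i)) ∈ ST from he)]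
      exact le_add_self
  have hprod : ∀ e : Equiv.Perm (Fin 4), ∏ i, ∫⁻ x, g (e i) x ^ 2 = ∏ i, ∫⁻ x, g i x ^ 2 :=
    fun e => Equiv.prod_comp e fun i => ∫⁻ x, g i x ^ 2
  have hB : ∀ e, ∫⁻ v, SB.indicator (f e) v ≤ ((C₁ + C₂) * M) ^ (1 / 2 : ℝ) := fun e =>
    ennreal_le_rpow_half_of_sq_le <| (h₁ Λ H (fun i => g (e i)) hH fun i => hg _).trans <| by
      rw [hprod e]
      exact mul_le_mul' le_self_add le_rfl
  have hT : ∀ e, ∫⁻ v, ST.indicator (f e) v ≤ ((C₁ + C₂) * M) ^ (1 / 2 : ℝ) := fun e =>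
    ennreal_le_rpow_half_of_sq_le <| (h₂ Λ H (fun i => g (e i)) hH fun i => hg _).trans <| by
      rw [hprod e]
      exact mul_le_mul' le_add_self le_rfl
  have hsum : ∫⁻ v, sliceIntegrand κ α Λ H g v ≤ 48 * ((C₁ + C₂) * M) ^ (1 / 2 : ℝ) := by
    refine (lintegral_mono hpt).trans ?_
    rw [lintegral_finsetSum _ fun e _ => by
      have h1 := hBm e
      have h2 := hTm e
      fun_prop]
    have h48 : ∀ e ∈ (Finset.univ : Finset (Equiv.Perm (Fin 4))),
        ∫⁻ v : Fin 4 → ℝ, (SB.indicator (f e) (fun i => v (e i)) + ST.indicator (f e) (fun i => v (e i))) ≤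
        2 * ((C₁ + C₂) * M) ^ (1 / 2 : ℝ) := by
      intro e _
      rw [lintegral_add_left (by have h1 := hBm e; fun_prop), lintegral_comp_perm e,
        lintegral_comp_perm e, two_mul]
      exact add_le_add (hB e) (hT e)
    refine (Finset.sum_le_card_nsmul _ _ _ h48).trans_eq ?_
    rw [Finset.card_univ, Fintype.card_perm, Fintype.card_fin, nsmul_eq_mul, ← mul_assoc]
    congr 1
    norm_num [Nat.factorial]
  calc _ ≤ (48 * ((C₁ + C₂) * M) ^ (1 / 2 : ℝ)) ^ 2 := by gcongr
    _ = _ := by rw [mul_pow, ennreal_rpow_half_sq, mul_assoc]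

theorem lintegral_fin_four_prod {f : Fin 4 → ℝ → ℝ≥0∞} (hf : ∀ i, Measurable (f i)) :
    ∫⁻ v : Fin 4 → ℝ, ∏ i, f i (v i) = ∏ i, ∫⁻ x, f i x := by
  have h := fun i => hf i
  rw [lintegral_fin_four (by fun_prop), Fin.prod_univ_four,
    ← lintegral_lintegral_lintegral_mul_mul (hf 0) (hf 1) (hf 2)]
  refine lintegral_congr fun a => lintegral_congr fun b => lintegral_congr fun c => ?_
  rw [← lintegral_const_mul _ (hf 3)]
  exact lintegral_congr fun d => by simp only [Fin.prod_univ_four, Matrix.cons_val]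

theorem measurePreserving_cubic_shear :
    MeasurePreserving (fun p : ℝ × ℝ => (p.1 + p.2 ^ 3, p.2)) := by
  have h : MeasurePreserving (fun p : ℝ × ℝ => (p.1, p.2 + p.1 ^ 3)) := by
    refine MeasurePreserving.skew_product (g := fun ξ τ => τ + ξ ^ 3) (MeasurePreserving.id volume)
      (by fun_prop) (.of_forall fun ξ => ?_)
    exact (measurePreserving_add_right volume (ξ ^ 3)).map_eq
  exact (Measure.measurePreserving_swap.comp h).comp Measure.measurePreserving_swap

theorem lintegral_pi_cubic_shear {f : (Fin 4 → ℝ × ℝ) → ℝ≥0∞} (hf : Measurable f) :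
    ∫⁻ p, f p = ∫⁻ l : Fin 4 → ℝ, ∫⁻ v : Fin 4 → ℝ, f fun i => (l i + v i ^ 3, v i) := by
  have h1 := volume_preserving_pi fun _ : Fin 4 => measurePreserving_cubic_shear
  rw [← h1.lintegral_comp hf]
  have h2 := (volume_measurePreserving_arrowProdEquivProdArrow ℝ ℝ (Fin 4)).symm
  have h3 : Measurable fun p : Fin 4 → ℝ × ℝ => f fun i => ((p i).1 + (p i).2 ^ 3, (p i).2) :=
    hf.comp h1.measurable
  rw [← h2.lintegral_comp h3, Measure.volume_eq_prod]
  exact lintegral_prod _ (h3.comp h2.measurable).aemeasurable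

theorem exists_sq_lintegral_modulated_le {α κ : ℝ} (hα0 : 0 < α) (hα : α < 1)
    (hκ0 : 0 ≤ κ) (hκ : 6 * κ ≤ 3 * α - 2) {ρ : ℝ → ℝ≥0∞} (hρ : Measurable ρ)
    (hρ2 : ∫⁻ x, ρ x ^ 2 ≠ ⊤) :
    ∃ C : ℝ≥0∞, C ≠ ⊤ ∧ ∀ (H : ℝ × ℝ → ℝ≥0∞) (G : Fin 4 → ℝ × ℝ → ℝ≥0∞), Measurable H →
      (∀ i, Measurable (G i)) →
      (∫⁻ p : Fin 4 → ℝ × ℝ, H (∑ i, (p i).1, ∑ i, (p i).2) *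
        (ENNReal.ofReal (freqWeight κ fun i => (p i).2) *
          ENNReal.ofReal (1 + |∑ i, (p i).1 - (∑ i, (p i).2) ^ 3|) ^ (-(α / 2))) *
        ∏ i, (ρ ((p i).1 - (p i).2 ^ 3) * G i (p i))) ^ 2 ≤
      C * ((∫⁻ p, H p ^ 2) * ∏ i, ∫⁻ p, G i p ^ 2) := by
  obtain ⟨C, hC, hsl⟩ := exists_sq_lintegral_sliceIntegrand_le hα0 hα hκ0 hκ
  refine ⟨C * (∫⁻ x, ρ x ^ 2) ^ 4, by finiteness, fun H G hH hG => ?_⟩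
  set g : Fin 4 → ℝ → ℝ → ℝ≥0∞ := fun i l x => G i (l + x ^ 3, x) with hg
  have hgm : ∀ i, Measurable fun p : ℝ × ℝ => g i p.1 p.2 := fun i => by
    have := hG i
    fun_prop
  have hgm1 : ∀ i l, Measurable (g i l) := fun i l => by
    have := hG i
    fun_prop
  set n : Fin 4 → ℝ → ℝ≥0∞ := fun i l => (∫⁻ x, g i l x ^ 2) ^ (1 / 2 : ℝ) with hn
  have hn2 : ∀ i, Measurable fun l => ∫⁻ x, g i l x ^ 2 := fun i =>
    ((hgm i).pow_const 2).lintegral_prod_right'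
  have hnm : ∀ i, Measurable (n i) := fun i => (hn2 i).pow_const _
  have hint : ∀ i, ∫⁻ l, ∫⁻ x, g i l x ^ 2 = ∫⁻ p, G i p ^ 2 := by
    intro i
    rw [← measurePreserving_cubic_shear.lintegral_comp ((hG i).pow_const 2), Measure.volume_eq_prod,
      lintegral_prod _ (by exact ((hgm i).pow_const 2).aemeasurable)]
  have hCS : ∀ i, (∫⁻ l, ρ l * n i l) ^ 2 ≤ (∫⁻ x, ρ x ^ 2) * ∫⁻ p, G i p ^ 2 := by
    intro i
    rw [← hint i]
    refine sq_lintegral_le_of_sq_le (hρ.pow_const 2).aemeasurable (hn2 i).aemeasurable fun l => ?_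
    rw [mul_pow, hn, ennreal_rpow_half_sq]
  have hinner : ∀ l : Fin 4 → ℝ, ∫⁻ v : Fin 4 → ℝ,
      (∏ i, ρ (l i)) * sliceIntegrand κ α (∑ i, l i) H (fun i => g i (l i)) v ≤
      (C * ∫⁻ p, H p ^ 2) ^ (1 / 2 : ℝ) * ∏ i, (ρ (l i) * n i (l i)) := by
    intro l
    rw [lintegral_const_mul _ (measurable_sliceIntegrand _ _ _ hH fun i => hgm1 i (l i)),
      Finset.prod_mul_distrib, mul_left_comm]
    refine mul_le_mul' le_rfl ?_
    have h := ennreal_le_rpow_half_of_sq_le (hsl (∑ i, l i) H (fun i => g i (l i)) hH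
      fun i => hgm1 i (l i))
    rwa [← mul_assoc, ENNReal.mul_rpow_of_nonneg _ _ (by norm_num),
      ← ENNReal.prod_rpow_of_nonneg (by norm_num)] at h
  have key : ∫⁻ p : Fin 4 → ℝ × ℝ, H (∑ i, (p i).1, ∑ i, (p i).2) *
        (ENNReal.ofReal (freqWeight κ fun i => (p i).2) *
          ENNReal.ofReal (1 + |∑ i, (p i).1 - (∑ i, (p i).2) ^ 3|) ^ (-(α / 2))) *
        ∏ i, (ρ ((p i).1 - (p i).2 ^ 3) * G i (p i)) ≤
      (C * ∫⁻ p, H p ^ 2) ^ (1 / 2 : ℝ) * ∏ i, ∫⁻ l, ρ l * n i l := by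
    rw [lintegral_pi_cubic_shear (by unfold freqWeight; fun_prop),
      ← lintegral_fin_four_prod (f := fun i l => ρ l * n i l) fun i => hρ.mul (hnm i),
      ← lintegral_const_mul _ (by have := hnm; fun_prop)]
    refine lintegral_mono fun l => le_trans (lintegral_mono fun v => ?_) (hinner l)
    simp only [sliceIntegrand, Finset.sum_add_distrib, add_sub_cancel_right,
      Finset.prod_mul_distrib]
    exact (mul_left_comm _ _ _).le
  calc _ ≤ ((C * ∫⁻ p, H p ^ 2) ^ (1 / 2 : ℝ) * ∏ i, ∫⁻ l, ρ l * n i l) ^ 2 := by gcongr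
    _ = (C * ∫⁻ p, H p ^ 2) * ∏ i, (∫⁻ l, ρ l * n i l) ^ 2 := by
        rw [mul_pow, ennreal_rpow_half_sq, Finset.prod_pow]
    _ ≤ (C * ∫⁻ p, H p ^ 2) * ∏ i, ((∫⁻ x, ρ x ^ 2) * ∫⁻ p, G i p ^ 2) := by
        refine mul_le_mul' le_rfl (Finset.prod_le_prod' fun i _ => hCS i)
    _ = _ := by
        rw [Finset.prod_mul_distrib, Finset.prod_const, Finset.card_univ, Fintype.card_fin]
        ring

theorem jap_pos (t x : ℝ) : 0 < jap t x := by
  unfold jap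
  positivity

theorem jap_neg (t x : ℝ) : jap (-t) x = (jap t x)⁻¹ := by
  rw [jap, jap, neg_div, Real.rpow_neg (by positivity)]

theorem one_add_abs_rpow_eq (t x : ℝ) : (1 + |x|) ^ t = ((1 + |x|) ^ 2) ^ (t / 2) := by
  rw [← Real.rpow_natCast, ← Real.rpow_mul (by positivity)]
  congr 1
  push_cast
  ring

theorem jap_le_one_add_abs_rpow {t : ℝ} (ht : 0 ≤ t) (x : ℝ) : jap t x ≤ (1 + |x|) ^ t := by
  rw [one_add_abs_rpow_eq, jap]
  refine Real.rpow_le_rpow (by positivity) ?_ (by positivity)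
  nlinarith [abs_nonneg x, sq_abs x]

theorem one_add_abs_rpow_le_jap {t : ℝ} (ht : 0 ≤ t) (x : ℝ) :
    (1 + |x|) ^ t ≤ 2 ^ (t / 2) * jap t x := by
  rw [one_add_abs_rpow_eq, jap, ← Real.mul_rpow (by positivity) (by positivity)]
  refine Real.rpow_le_rpow (by positivity) ?_ (by positivity)
  nlinarith [sq_nonneg (|x| - 1), sq_abs x]

theorem jap_neg_le_one_add_abs_rpow {t : ℝ} (ht : 0 ≤ t) (x : ℝ) :
    jap (-t) x ≤ 2 ^ (t / 2) * (1 + |x|) ^ (-t) := by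
  have h := one_add_abs_rpow_le_jap ht x
  have := jap_pos t x
  rw [jap_neg, Real.rpow_neg (by positivity), ← div_eq_mul_inv, le_div_iff₀ (by positivity),
    inv_mul_le_iff₀ this, mul_comm]
  exact h

theorem one_add_abs_rpow_neg_le_jap {t : ℝ} (ht : 0 ≤ t) (x : ℝ) :
    (1 + |x|) ^ (-t) ≤ jap (-t) x := by
  rw [jap_neg, Real.rpow_neg (by positivity)]
  exact inv_anti₀ (jap_pos t x) (jap_le_one_add_abs_rpow ht x)

theorem one_add_abs_sum_le_prod {ι : Type*} (S : Finset ι) (v : ι → ℝ) :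
    1 + |∑ i ∈ S, v i| ≤ ∏ i ∈ S, (1 + |v i|) := by
  classical
  induction S using Finset.induction_on with
  | empty => simp
  | insert a S ha ih =>
    rw [Finset.sum_insert ha, Finset.prod_insert ha]
    nlinarith [abs_add_le (v a) (∑ i ∈ S, v i), abs_nonneg (v a), abs_nonneg (∑ i ∈ S, v i)]

theorem exists_jap_sum_le (s : ℝ) : ∃ C > (0 : ℝ), ∀ v : Fin 4 → ℝ,
    jap s (∑ i, v i) ≤ C * ((1 + |∑ i, v i|) ^ (-(max (-s) 0)) *
      ∏ i, (1 + |v i|) ^ (max (-s) 0)) * ∏ i, jap s (v i) := by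
  rcases le_total s 0 with hs | hs
  · refine ⟨2 ^ (-s / 2), by positivity, fun v => ?_⟩
    rw [max_eq_left (by linarith), mul_assoc, mul_assoc, ← Finset.prod_mul_distrib]
    have h1 : 1 ≤ ∏ i, (1 + |v i|) ^ (-s) * jap s (v i) := by
      refine (Finset.prod_const_one (s := (Finset.univ : Finset (Fin 4)))).ge.trans ?_
      refine Finset.prod_le_prod (fun _ _ => zero_le_one) fun i _ => ?_
      have := one_add_abs_rpow_neg_le_jap (neg_nonneg.2 hs) (v i)
      rw [neg_neg] at this
      calc (1 : ℝ) = (1 + |v i|) ^ (-s) * (1 + |v i|) ^ s := by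
            rw [← Real.rpow_add (by positivity)]; simp
        _ ≤ _ := by gcongr
    have h2 := jap_neg_le_one_add_abs_rpow (neg_nonneg.2 hs) (∑ i, v i)
    rw [neg_neg] at h2
    calc _ ≤ _ := h2
      _ ≤ 2 ^ (-s / 2) * ((1 + |∑ i, v i|) ^ (- -s) * 1) := by rw [neg_neg, mul_one]
      _ ≤ _ := by gcongr
  · refine ⟨∏ _i : Fin 4, 2 ^ (s / 2), by positivity, fun v => ?_⟩
    rw [max_eq_right (by linarith)]
    simp only [neg_zero, Real.rpow_zero, Finset.prod_const_one, mul_one]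
    rw [← Finset.prod_mul_distrib]
    calc _ ≤ (1 + |∑ i, v i|) ^ s := jap_le_one_add_abs_rpow hs _
      _ ≤ (∏ i, (1 + |v i|)) ^ s := by
          gcongr
          exact one_add_abs_sum_le_prod _ v
      _ = ∏ i, (1 + |v i|) ^ s := (Real.finsetProd_rpow _ _ (fun i _ => by positivity) _).symm
      _ ≤ _ := Finset.prod_le_prod (fun i _ => by positivity) fun i _ =>
          one_add_abs_rpow_le_jap hs _

/-- The Gevrey–Bourgain weight. -/
def bourgainWeight (σ s b : ℝ) (p : ℝ × ℝ) : ℝ :=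
  Real.exp (σ * |p.2|) * jap s p.2 * jap b (p.1 - p.2 ^ 3)

theorem bourgainWeight_pos (σ s b : ℝ) (p : ℝ × ℝ) : 0 < bourgainWeight σ s b p :=
  mul_pos (mul_pos (Real.exp_pos _) (jap_pos _ _)) (jap_pos _ _)

theorem measurable_bourgainWeight (σ s b : ℝ) : Measurable (bourgainWeight σ s b) := by
  unfold bourgainWeight jap
  fun_prop

theorem exp_mul_abs_sum_le_prod {σ : ℝ} (hσ : 0 ≤ σ) {ι : Type*} (S : Finset ι) (v : ι → ℝ) :
    Real.exp (σ * |∑ i ∈ S, v i|) ≤ ∏ i ∈ S, Real.exp (σ * |v i|) := by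
  rw [← Real.exp_sum, ← Finset.mul_sum]
  gcongr
  exact Finset.abs_sum_le_sum_abs _ _

theorem exists_bourgainWeight_sum_le (s b : ℝ) {b' : ℝ} (hb' : b' ≤ 0) :
    ∃ C > (0 : ℝ), ∀ σ, 0 ≤ σ → ∀ p : Fin 4 → ℝ × ℝ,
      |∑ i, (p i).2| * bourgainWeight σ s b' (∑ i, (p i).1, ∑ i, (p i).2) ≤
      C * (freqWeight (max (-s) 0) (fun i => (p i).2) *
        (1 + |∑ i, (p i).1 - (∑ i, (p i).2) ^ 3|) ^ b') *
        ∏ i, ((jap b ((p i).1 - (p i).2 ^ 3))⁻¹ * bourgainWeight σ s b (p i)) := by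
  obtain ⟨C, hC, h⟩ := exists_jap_sum_le s
  refine ⟨C * 2 ^ (-b' / 2), by positivity, fun σ hσ p => ?_⟩
  have hw : ∀ i, (jap b ((p i).1 - (p i).2 ^ 3))⁻¹ * bourgainWeight σ s b (p i) =
      Real.exp (σ * |(p i).2|) * jap s (p i).2 := fun i => by
    have := (jap_pos b ((p i).1 - (p i).2 ^ 3)).ne'
    unfold bourgainWeight
    field_simp
  simp only [hw, Finset.prod_mul_distrib]
  have h1 := exp_mul_abs_sum_le_prod hσ Finset.univ fun i => (p i).2
  have h2 := h fun i => (p i).2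
  have h3 := jap_neg_le_one_add_abs_rpow (neg_nonneg.2 hb') (∑ i, (p i).1 - (∑ i, (p i).2) ^ 3)
  rw [neg_neg] at h3
  have n1 := (jap_pos s (∑ i, (p i).2)).le
  have n2 := (jap_pos b' (∑ i, (p i).1 - (∑ i, (p i).2) ^ 3)).le
  unfold bourgainWeight freqWeight
  calc _ ≤ |∑ i, (p i).2| * ((∏ i, Real.exp (σ * |(p i).2|)) * _ * _) := by
        refine mul_le_mul_of_nonneg_left (mul_le_mul (mul_le_mul h1 h2 n1 ?_) h3 n2 ?_)
          (abs_nonneg _)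
        · positivity
        · exact mul_nonneg (by positivity) (n1.trans h2)
    _ = _ := by ring

theorem lintegral_sq_ofReal_jap_inv_ne_top {b : ℝ} (hb : 1 / 2 < b) :
    ∫⁻ x, ENNReal.ofReal (jap b x)⁻¹ ^ 2 ≠ ⊤ := by
  have h := integrable_rpow_neg_one_add_norm_sq (E := ℝ) (μ := volume) (r := 2 * b)
    (by simp; linarith)
  refine ne_of_eq_of_ne (lintegral_congr fun x => ?_) h.lintegral_lt_top.ne
  rw [← ENNReal.ofReal_pow (inv_nonneg.2 (jap_pos b x).le), ← jap_neg, jap, ← Real.rpow_natCast,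
    ← Real.rpow_mul (by positivity), Real.norm_eq_abs, sq_abs]
  congr 2
  push_cast
  ring

theorem exists_sq_lintegral_weighted_le {s b b' : ℝ} (hb : 1 / 2 < b) (hb'₁ : -(1 / 2) < b')
    (hb'₂ : s ≤ 0 → b' < s - 1 / 3) (hb'₃ : 0 ≤ s → b' < -(1 / 3)) :
    ∃ C : ℝ≥0∞, C ≠ ⊤ ∧ ∀ σ : ℝ, 0 ≤ σ → ∀ (H : ℝ × ℝ → ℝ≥0∞) (F : Fin 4 → ℝ × ℝ → ℝ≥0∞),
      Measurable H → (∀ i, Measurable (F i)) →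
      (∫⁻ p : Fin 4 → ℝ × ℝ, H (∑ i, p i) * ENNReal.ofReal (|(∑ i, p i).2| *
        bourgainWeight σ s b' (∑ i, p i)) * ∏ i, F i (p i)) ^ 2 ≤
      C * ((∫⁻ p, H p ^ 2) * ∏ i, ∫⁻ p, (ENNReal.ofReal (bourgainWeight σ s b p) * F i p) ^ 2) := by
  have hb0 : b' < -(1 / 3) := by
    rcases le_total s 0 with h | h
    · linarith [hb'₂ h]
    · exact hb'₃ h
  have hκ : 6 * max (-s) 0 ≤ 3 * (-2 * b') - 2 := by
    rcases le_total s 0 with h | h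
    · rw [max_eq_left (by linarith)]
      linarith [hb'₂ h]
    · rw [max_eq_right (by linarith)]
      linarith [hb'₃ h]
  have hρ : Measurable fun x => ENNReal.ofReal (jap b x)⁻¹ := by
    unfold jap
    fun_prop
  obtain ⟨C₁, hC₁, h₁⟩ := exists_sq_lintegral_modulated_le (α := -2 * b') (by linarith)
    (by linarith) (le_max_right (-s) 0) hκ hρ (lintegral_sq_ofReal_jap_inv_ne_top hb)
  obtain ⟨C₂, hC₂, h₂⟩ := exists_bourgainWeight_sum_le s b (b' := b') (by linarith)
  refine ⟨ENNReal.ofReal C₂ ^ 2 * C₁, by finiteness, fun σ hσ H F hH hF => ?_⟩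
  have h := h₁ H (fun i p => ENNReal.ofReal (bourgainWeight σ s b p) * F i p) hH fun i =>
    (measurable_bourgainWeight σ s b).ennreal_ofReal.mul (hF i)
  rw [mul_assoc]
  refine le_trans ?_ (mul_le_mul_right h _)
  rw [← mul_pow, ← lintegral_const_mul' _ _ ENNReal.ofReal_ne_top]
  refine pow_le_pow_left' (lintegral_mono fun p => ?_) 2
  have hsum : ∑ i, p i = (∑ i, (p i).1, ∑ i, (p i).2) := by
    ext <;> simp [Prod.fst_sum, Prod.snd_sum]
  rw [hsum]
  have hp := ENNReal.ofReal_le_ofReal (h₂ σ hσ p)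
  have hn : ∀ i, 0 ≤ (jap b ((p i).1 - (p i).2 ^ 3))⁻¹ * bourgainWeight σ s b (p i) := fun i =>
    mul_nonneg (inv_nonneg.2 (jap_pos _ _).le) (bourgainWeight_pos _ _ _ _).le
  have hfw : 0 ≤ freqWeight (max (-s) 0) fun i => (p i).2 := by
    unfold freqWeight
    positivity
  rw [ENNReal.ofReal_mul (p := C₂ * _) (by positivity), ENNReal.ofReal_mul (p := C₂) hC₂.le,
    ENNReal.ofReal_mul hfw, ENNReal.ofReal_prod_of_nonneg fun i _ => hn i,
    ← ENNReal.ofReal_rpow_of_pos (by positivity)] at hp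
  simp only [ENNReal.ofReal_mul (inv_nonneg.2 (jap_pos _ _).le)] at hp
  have hα : -(-2 * b' / 2) = b' := by ring
  simp only [hα, ← mul_assoc, Finset.prod_mul_distrib] at hp ⊢
  refine (mul_le_mul_left (mul_le_mul_right hp _) _).trans_eq ?_
  ring

theorem lintegral_sq_le_of_forall_sq_lintegral_mul_le {α : Type*} [MeasurableSpace α]
    {μ : Measure α} [SigmaFinite μ] {T : α → NNReal} {K : ℝ≥0∞}
    (h : ∀ H : α → ℝ≥0∞, Measurable H → (∫⁻ x, H x * T x ∂μ) ^ 2 ≤ K * ∫⁻ x, H x ^ 2 ∂μ) :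
    ∫⁻ x, (T x : ℝ≥0∞) ^ 2 ∂μ ≤ K := by
  by_contra! hK
  simp only [← ENNReal.coe_pow] at hK
  obtain ⟨g, hg, hgt, hKg⟩ := exists_lt_lintegral_simpleFunc_of_lt_lintegral hK
  have hm : Measurable fun x => (g x : ℝ≥0∞) := g.measurable.coe_nnreal_ennreal
  set I := ∫⁻ x, (g x : ℝ≥0∞) ∂μ
  have hI : ∫⁻ x, (((g x : ℝ≥0∞) ^ (1 / 2 : ℝ)) ^ 2) ∂μ = I :=
    lintegral_congr fun x => ennreal_rpow_half_sq _
  have h' := h _ (hm.pow_const (1 / 2 : ℝ))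
  have hle : I ≤ ∫⁻ x, (g x : ℝ≥0∞) ^ (1 / 2 : ℝ) * T x ∂μ := by
    refine lintegral_mono fun x => ?_
    calc (g x : ℝ≥0∞) = (g x : ℝ≥0∞) ^ (1 / 2 : ℝ) * (g x : ℝ≥0∞) ^ (1 / 2 : ℝ) := by
          rw [← sq, ennreal_rpow_half_sq]
      _ ≤ (g x : ℝ≥0∞) ^ (1 / 2 : ℝ) * (T x ^ 2) ^ (1 / 2 : ℝ) := by
          gcongr
          exact_mod_cast hg x
      _ = _ := by rw [← ENNReal.rpow_natCast, ← ENNReal.rpow_mul]; norm_num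
  rw [hI] at h'
  have h2 : I * I ≤ K * I := by
    rw [← sq]
    exact (pow_le_pow_left' hle 2).trans h'
  exact absurd ((ENNReal.mul_le_mul_iff_left (pos_of_gt hKg).ne' hgt.ne).1 h2) (not_le.2 hKg)

section

open scoped FourierTransform SchwartzMap LineDeriv

/-- A Schwartz function on `ℝ × ℝ`, viewed on `ℂ`, which carries the Euclidean inner product. -/
def schwartzOnComplex (φ : 𝓢(ℝ × ℝ, ℂ)) : 𝓢(ℂ, ℂ) :=
  SchwartzMap.compCLMOfContinuousLinearEquiv ℂ Complex.equivRealProdCLM φ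

theorem schwartzOnComplex_apply (φ : 𝓢(ℝ × ℝ, ℂ)) (z : ℂ) :
    schwartzOnComplex φ z = φ (z.re, z.im) := by
  simp [schwartzOnComplex]

theorem integral_complex_eq_integral_prod (f : ℂ → ℂ) :
    ∫ z, f z = ∫ p : ℝ × ℝ, f (Complex.equivRealProdCLM.symm p) := by
  rw [← Complex.volume_preserving_equiv_real_prod.symm.integral_comp'
    (f := Complex.measurableEquivRealProd.symm)]
  rfl

/-- The frequency at which Mathlib's inverse Fourier transform on `ℂ` computes `FT2`. -/
def complexFrequency (p : ℝ × ℝ) : ℂ := Complex.equivRealProdCLM.symm ((2 * Real.pi)⁻¹ • p)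

theorem FT2_eq_fourierInv (φ : 𝓢(ℝ × ℝ, ℂ)) (p : ℝ × ℝ) :
    FT2 (fun t x => φ (t, x)) p.1 p.2 = 𝓕⁻ (schwartzOnComplex φ) (complexFrequency p) := by
  rw [SchwartzMap.fourierInv_coe, Real.fourierInv_eq', integral_complex_eq_integral_prod, FT2]
  congr 1
  ext q
  simp only [schwartzOnComplex_apply, smul_eq_mul, Complex.inner, complexFrequency]
  congr 2
  · have : (Real.pi : ℂ) ≠ 0 := by exact_mod_cast Real.pi_ne_zero
    simp
    field_simp

theorem continuous_FT2 (φ : 𝓢(ℝ × ℝ, ℂ)) :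
    Continuous fun p : ℝ × ℝ => FT2 (fun t x => φ (t, x)) p.1 p.2 := by
  simp only [FT2_eq_fourierInv, complexFrequency]
  fun_prop

theorem FT2_mul_eq_integral (φ ψ : 𝓢(ℝ × ℝ, ℂ)) (p : ℝ × ℝ) :
    FT2 (fun t x => φ (t, x) * ψ (t, x)) p.1 p.2 =
      ((2 * Real.pi)⁻¹ ^ 2 : ℝ) • ∫ q : ℝ × ℝ, FT2 (fun t x => φ (t, x)) q.1 q.2 *
        FT2 (fun t x => ψ (t, x)) (p - q).1 (p - q).2 := by
  have hmul : schwartzOnComplex (SchwartzMap.pairing (ContinuousLinearMap.mul ℂ ℂ) φ ψ) =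
      𝓕 (SchwartzMap.convolution (ContinuousLinearMap.mul ℂ ℂ) (𝓕⁻ (schwartzOnComplex φ))
        (𝓕⁻ (schwartzOnComplex ψ))) := by
    rw [SchwartzMap.fourier_convolution]
    ext z
    simp [schwartzOnComplex_apply, SchwartzMap.pairing_apply_apply]
  have h := FT2_eq_fourierInv (SchwartzMap.pairing (ContinuousLinearMap.mul ℂ ℂ) φ ψ) p
  rw [hmul, FourierTransform.fourierInv_fourier_eq, SchwartzMap.convolution_apply, convolution_def,
    integral_complex_eq_integral_prod] at h
  simp only [SchwartzMap.pairing_apply_apply, ContinuousLinearMap.mul_apply'] at h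
  rw [h]
  simp only [FT2_eq_fourierInv]
  have hs := Measure.integral_comp_smul (volume : Measure (ℝ × ℝ)) (fun q =>
    𝓕⁻ (schwartzOnComplex φ) (Complex.equivRealProdCLM.symm q) *
      𝓕⁻ (schwartzOnComplex ψ) (complexFrequency p - Complex.equivRealProdCLM.symm q))
    (2 * Real.pi)⁻¹
  have hsub : ∀ q, complexFrequency (p - q) = complexFrequency p - complexFrequency q := fun q => by
    simp only [complexFrequency, smul_sub, map_sub]
  simp only [hsub]
  simp only [complexFrequency] at hs ⊢
  have hf : Module.finrank ℝ (ℝ × ℝ) = 2 := by simp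
  rw [hs, hf, smul_smul, abs_of_pos (by positivity), mul_inv_cancel₀ (by positivity), one_smul]

theorem enorm_FT2_mul_le (φ ψ : 𝓢(ℝ × ℝ, ℂ)) (p : ℝ × ℝ) :
    ‖FT2 (fun t x => φ (t, x) * ψ (t, x)) p.1 p.2‖ₑ ≤
      ‖((2 * Real.pi)⁻¹ ^ 2 : ℝ)‖ₑ * ∫⁻ q : ℝ × ℝ, ‖FT2 (fun t x => φ (t, x)) q.1 q.2‖ₑ *
        ‖FT2 (fun t x => ψ (t, x)) (p - q).1 (p - q).2‖ₑ := by
  rw [FT2_mul_eq_integral, enorm_smul]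
  gcongr
  refine (enorm_integral_le_lintegral_enorm _).trans_eq ?_
  simp only [enorm_mul]

theorem enorm_FT2_deriv (φ : 𝓢(ℝ × ℝ, ℂ)) (p : ℝ × ℝ) :
    ‖FT2 (fun t x => deriv (fun y => φ (t, y)) x) p.1 p.2‖ₑ =
      ENNReal.ofReal |p.2| * ‖FT2 (fun t x => φ (t, x)) p.1 p.2‖ₑ := by
  have hd : (fun t x => deriv (fun y => φ (t, y)) x) = fun t x =>
      (∂_{((0 : ℝ), (1 : ℝ))} φ) (t, x) := by
    ext t x
    rw [SchwartzMap.lineDerivOp_apply_eq_fderiv]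
    have h1 : HasFDerivAt φ (fderiv ℝ φ (t, x)) (t, x) := φ.differentiableAt.hasFDerivAt
    have h2 : HasDerivAt (fun y : ℝ => (t, y)) ((0 : ℝ), (1 : ℝ)) x :=
      (hasDerivAt_const x t).prodMk (hasDerivAt_id x)
    exact (h1.comp_hasDerivAt x h2).deriv
  have hΦ : schwartzOnComplex (∂_{((0 : ℝ), (1 : ℝ))} φ) = ∂_{Complex.I} (schwartzOnComplex φ) := by
    rw [schwartzOnComplex, schwartzOnComplex, SchwartzMap.lineDerivOp_compCLMOfContinuousLinearEquiv]
    simp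
  have ht : (fun x : ℂ => inner ℝ x Complex.I).HasTemperateGrowth := by fun_prop
  rw [hd, FT2_eq_fourierInv, hΦ, SchwartzMap.fourierInv_lineDerivOp_eq, smul_apply,
    SchwartzMap.smulLeftCLM_apply_apply ht, ← FT2_eq_fourierInv, enorm_smul, enorm_smul, ← mul_assoc]
  congr 1
  rw [← ofReal_norm, ← ofReal_norm, ← ENNReal.ofReal_mul (norm_nonneg _)]
  congr 1
  have : Real.pi ≠ 0 := Real.pi_ne_zero
  simp [Complex.inner, complexFrequency, abs_of_pos Real.pi_pos]
  field_simp

theorem lintegral_mul_lintegral_sub {E : Type*} [AddCommGroup E] [MeasurableSpace E]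
    [MeasurableAdd₂ E] [MeasurableSub₂ E] {μ : Measure E} [SFinite μ] [μ.IsAddRightInvariant]
    {K f g : E → ℝ≥0∞} (hK : Measurable K) (hf : Measurable f) (hg : Measurable g) :
    ∫⁻ p, K p * ∫⁻ q, f q * g (p - q) ∂μ ∂μ = ∫⁻ y, g y * ∫⁻ x, K (y + x) * f x ∂μ ∂μ := by
  calc _ = ∫⁻ p, ∫⁻ q, K p * (f q * g (p - q)) ∂μ ∂μ :=
        lintegral_congr fun p => (lintegral_const_mul _ (by fun_prop)).symm
    _ = ∫⁻ q, ∫⁻ p, K p * (f q * g (p - q)) ∂μ ∂μ := lintegral_lintegral_swap (by fun_prop)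
    _ = ∫⁻ q, ∫⁻ p, K (p + q) * (f q * g p) ∂μ ∂μ := lintegral_congr fun q => by
        rw [← lintegral_add_right_eq_self _ q]
        simp only [add_sub_cancel_right]
    _ = ∫⁻ p, ∫⁻ q, K (p + q) * (f q * g p) ∂μ ∂μ := lintegral_lintegral_swap (by fun_prop)
    _ = _ := lintegral_congr fun p => by
        rw [← lintegral_const_mul _ (by fun_prop)]
        exact lintegral_congr fun q => by ring

theorem exists_lintegral_mul_enorm_FT2_mul_le : ∃ C : ℝ≥0∞, C ≠ ⊤ ∧ ∀ φ ψ : 𝓢(ℝ × ℝ, ℂ),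
    ∀ {K : ℝ × ℝ → ℝ≥0∞}, Measurable K →
    ∫⁻ p, K p * ‖FT2 (fun t x => φ (t, x) * ψ (t, x)) p.1 p.2‖ₑ ≤
      C * ∫⁻ y : ℝ × ℝ, ‖FT2 (fun t x => ψ (t, x)) y.1 y.2‖ₑ *
        ∫⁻ x : ℝ × ℝ, K (y + x) * ‖FT2 (fun t x => φ (t, x)) x.1 x.2‖ₑ := by
  refine ⟨‖((2 * Real.pi)⁻¹ ^ 2 : ℝ)‖ₑ, enorm_ne_top, fun φ ψ K hK => ?_⟩
  have hφ := (continuous_FT2 φ).enorm.measurable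
  have hψ := (continuous_FT2 ψ).enorm.measurable
  rw [← lintegral_mul_lintegral_sub hK hφ hψ, ← lintegral_const_mul' _ _ enorm_ne_top]
  refine lintegral_mono fun p => ?_
  refine (mul_le_mul_right (enorm_FT2_mul_le φ ψ p) (K p)).trans_eq ?_
  ring

theorem exists_lintegral_mul_enorm_FT2_mul_four_le : ∃ C : ℝ≥0∞, C ≠ ⊤ ∧
    ∀ (φ : Fin 4 → 𝓢(ℝ × ℝ, ℂ)) {K : ℝ × ℝ → ℝ≥0∞}, Measurable K →
    ∫⁻ p, K p * ‖FT2 (fun t x => φ 0 (t, x) * φ 1 (t, x) * φ 2 (t, x) * φ 3 (t, x)) p.1 p.2‖ₑ ≤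
      C * ∫⁻ p : Fin 4 → ℝ × ℝ, K (∑ i, p i) *
        ∏ i, ‖FT2 (fun t x => φ i.rev (t, x)) (p i).1 (p i).2‖ₑ := by
  obtain ⟨c, hc, key⟩ := exists_lintegral_mul_enorm_FT2_mul_le
  refine ⟨c ^ 3, by finiteness, fun φ K hK => ?_⟩
  set B := ContinuousLinearMap.mul ℂ ℂ
  have h1 := key (.pairing B (.pairing B (φ 0) (φ 1)) (φ 2)) (φ 3) hK
  have h2 := fun a : ℝ × ℝ => key (.pairing B (φ 0) (φ 1)) (φ 2)
    (K := fun x => K (a + x)) (by fun_prop)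
  have h3 := fun a b : ℝ × ℝ => key (φ 0) (φ 1)
    (K := fun x => K (a + (b + x))) (by fun_prop)
  simp only [SchwartzMap.pairing_apply_apply, B, ContinuousLinearMap.mul_apply'] at h1 h2 h3
  have hm : ∀ i, Measurable fun p : Fin 4 → ℝ × ℝ =>
      ‖FT2 (fun t x => φ i.rev (t, x)) (p i).1 (p i).2‖ₑ := fun i =>
    (continuous_FT2 (φ i.rev)).enorm.measurable.comp (measurable_pi_apply i)
  have hm' : Measurable fun p : Fin 4 → ℝ × ℝ => K (∑ i, p i) *
      ∏ i, ‖FT2 (fun t x => φ i.rev (t, x)) (p i).1 (p i).2‖ₑ :=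
    (hK.comp (by fun_prop)).mul (Finset.measurable_fun_prod _ fun i _ => hm i)
  rw [lintegral_fin_four hm']
  refine h1.trans ?_
  rw [pow_succ', mul_assoc]
  refine mul_le_mul_right ?_ c
  rw [← lintegral_const_mul' _ _ (by finiteness)]
  refine lintegral_mono fun a => (mul_le_mul_right (h2 a) _).trans ?_
  rw [mul_left_comm, pow_succ', mul_assoc]
  refine mul_le_mul_right ?_ c
  rw [← lintegral_const_mul' _ _ enorm_ne_top, ← lintegral_const_mul' _ _ (by finiteness)]
  refine lintegral_mono fun b => ?_
  refine (mul_le_mul_right (mul_le_mul_right (h3 a b) _) _).trans_eq ?_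
  rw [mul_left_comm _ c, mul_left_comm _ c, pow_one]
  congr 1
  rw [← lintegral_const_mul' _ _ enorm_ne_top, ← lintegral_const_mul' _ _ enorm_ne_top]
  refine lintegral_congr fun d => ?_
  rw [← lintegral_const_mul' _ _ enorm_ne_top, ← lintegral_const_mul' _ _ enorm_ne_top,
    ← lintegral_const_mul' _ _ enorm_ne_top]
  refine lintegral_congr fun e => ?_
  simp [Fin.sum_univ_four, Fin.prod_univ_four, Fin.rev, add_assoc]
  ring

theorem XNorm_sq (σ s b : ℝ) (u : ℝ → ℝ → ℂ) :
    XNorm σ s b u ^ 2 =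
      ∫⁻ p : ℝ × ℝ, (ENNReal.ofReal (bourgainWeight σ s b p) * ‖FT2 u p.1 p.2‖ₑ) ^ 2 := by
  have h := eLpNorm_nnreal_pow_eq_lintegral (f := fun p : ℝ × ℝ =>
    ((bourgainWeight σ s b p : ℝ) : ℂ) * FT2 u p.1 p.2) (μ := volume) (p := 2) two_ne_zero
  simp only [ENNReal.coe_ofNat, NNReal.coe_ofNat, ENNReal.rpow_ofNat] at h
  refine h.trans (lintegral_congr fun p => ?_)
  rw [enorm_mul, ← ofReal_norm, Complex.norm_real, Real.norm_of_nonneg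
    (bourgainWeight_pos _ _ _ _).le]

theorem exists_XNorm_deriv_mul_four_sq_le {s b b' : ℝ} (hb : 1 / 2 < b) (hb'₁ : -(1 / 2) < b')
    (hb'₂ : s ≤ 0 → b' < s - 1 / 3) (hb'₃ : 0 ≤ s → b' < -(1 / 3)) :
    ∃ C : ℝ≥0∞, C ≠ ⊤ ∧ ∀ σ : ℝ, 0 ≤ σ → ∀ φ : Fin 4 → 𝓢(ℝ × ℝ, ℂ),
      XNorm σ s b' (fun t x => deriv (fun y =>
        φ 0 (t, y) * φ 1 (t, y) * φ 2 (t, y) * φ 3 (t, y)) x) ^ 2 ≤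
      C * ∏ i, XNorm σ s b (fun t x => φ i (t, x)) ^ 2 := by
  obtain ⟨C₁, hC₁, h₁⟩ := exists_sq_lintegral_weighted_le hb hb'₁ hb'₂ hb'₃
  obtain ⟨C₂, hC₂, h₂⟩ := exists_lintegral_mul_enorm_FT2_mul_four_le
  refine ⟨C₂ ^ 2 * C₁, by finiteness, fun σ hσ φ => ?_⟩
  set B := ContinuousLinearMap.mul ℂ ℂ
  have hderiv := enorm_FT2_deriv (.pairing B (.pairing B (.pairing B (φ 0) (φ 1)) (φ 2)) (φ 3))
  simp only [SchwartzMap.pairing_apply_apply, B, ContinuousLinearMap.mul_apply'] at hderiv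
  rw [XNorm_sq]
  have hT : ∀ p : ℝ × ℝ, (((bourgainWeight σ s b' p).toNNReal * ‖FT2 (fun t x => deriv (fun y =>
      φ 0 (t, y) * φ 1 (t, y) * φ 2 (t, y) * φ 3 (t, y)) x) p.1 p.2‖₊ : NNReal) : ℝ≥0∞) =
      ENNReal.ofReal (bourgainWeight σ s b' p) * ‖FT2 (fun t x => deriv (fun y =>
      φ 0 (t, y) * φ 1 (t, y) * φ 2 (t, y) * φ 3 (t, y)) x) p.1 p.2‖ₑ := fun p => by
    rw [ENNReal.coe_mul]
    rfl
  simp only [← hT]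
  refine lintegral_sq_le_of_forall_sq_lintegral_mul_le fun H hH => ?_
  have hK : Measurable fun p : ℝ × ℝ => H p * ENNReal.ofReal (|p.2| * bourgainWeight σ s b' p) := by
    have := measurable_bourgainWeight σ s b'
    fun_prop
  have h₃ := h₁ σ hσ H (fun i p => ‖FT2 (fun t x => φ i.rev (t, x)) p.1 p.2‖ₑ) hH fun i =>
    (continuous_FT2 _).enorm.measurable
  simp only [← XNorm_sq] at h₃
  have hrev : ∏ i : Fin 4, XNorm σ s b (fun t x => φ i.rev (t, x)) ^ 2 =
      ∏ i, XNorm σ s b (fun t x => φ i (t, x)) ^ 2 :=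
    Fin.revPerm.prod_comp Finset.univ (fun i => XNorm σ s b (fun t x => φ i (t, x)) ^ 2) (by simp)
  rw [hrev] at h₃
  have : ∀ p, H p * (((bourgainWeight σ s b' p).toNNReal * ‖FT2 (fun t x => deriv (fun y =>
      φ 0 (t, y) * φ 1 (t, y) * φ 2 (t, y) * φ 3 (t, y)) x) p.1 p.2‖₊ : NNReal) : ℝ≥0∞) =
      H p * ENNReal.ofReal (|p.2| * bourgainWeight σ s b' p) *
        ‖FT2 (fun t x => φ 0 (t, x) * φ 1 (t, x) * φ 2 (t, x) * φ 3 (t, x)) p.1 p.2‖ₑ := fun p => by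
    rw [hT, hderiv, ENNReal.ofReal_mul (abs_nonneg _)]
    ring
  simp only [this]
  refine (pow_le_pow_left' (h₂ φ hK) 2).trans ?_
  rw [mul_pow]
  refine (mul_le_mul_right h₃ _).trans_eq ?_
  ring

end

/-- Quadrilinear estimate in Gevrey–Bourgain spaces, with a constant independent of `σ ≥ 0`:
for `s > -1/6`, `b > 1/2`, and `b'` with `-1/2 < b' < s - 1/3` if `-1/6 < s ≤ 0` and
`-1/2 < b' < -1/3` if `s ≥ 0`, one has
`‖∂_x(u₁u₂u₃u₄)‖_{X^{σ,s,b'}} ≤ C ∏ ‖uⱼ‖_{X^{σ,s,b}}` for Schwartz `u₁,…,u₄`. -/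
theorem quadrilinear_Xsigmasb (s b b' : ℝ) (hs : -(1/6) < s) (hb : 1/2 < b)
    (hb'₁ : -(1/2) < b') (hb'₂ : s ≤ 0 → b' < s - 1/3) (hb'₃ : 0 ≤ s → b' < -(1/3)) :
    ∃ C > (0 : ℝ), ∀ σ : ℝ, 0 ≤ σ → ∀ u₁ u₂ u₃ u₄ : ℝ → ℝ → ℂ,
      IsSchwartz u₁ → IsSchwartz u₂ → IsSchwartz u₃ → IsSchwartz u₄ →
      XNorm σ s b' (fun t x => deriv (fun y => u₁ t y * u₂ t y * u₃ t y * u₄ t y) x) ≤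
        ENNReal.ofReal C *
          (XNorm σ s b u₁ * XNorm σ s b u₂ * XNorm σ s b u₃ * XNorm σ s b u₄) := by
  obtain ⟨K, hK, h⟩ := exists_XNorm_deriv_mul_four_sq_le hb hb'₁ hb'₂ hb'₃
  refine ⟨(K ^ (1 / 2 : ℝ)).toReal + 1, by positivity, ?_⟩
  rintro σ hσ u₁ u₂ u₃ u₄ ⟨φ₁, h₁⟩ ⟨φ₂, h₂⟩ ⟨φ₃, h₃⟩ ⟨φ₄, h₄⟩
  obtain rfl : u₁ = fun t x => φ₁ (t, x) := by ext; exact h₁ ..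
  obtain rfl : u₂ = fun t x => φ₂ (t, x) := by ext; exact h₂ ..
  obtain rfl : u₃ = fun t x => φ₃ (t, x) := by ext; exact h₃ ..
  obtain rfl : u₄ = fun t x => φ₄ (t, x) := by ext; exact h₄ ..
  have hle : K ^ (1 / 2 : ℝ) ≤ ENNReal.ofReal ((K ^ (1 / 2 : ℝ)).toReal + 1) :=
    (ENNReal.ofReal_toReal (ENNReal.rpow_ne_top_of_nonneg (by norm_num) hK)).ge.trans
      (ENNReal.ofReal_le_ofReal (by linarith))
  refine le_trans ?_ (mul_le_mul_left hle _)
  refine (ENNReal.pow_le_pow_left_iff two_ne_zero).1 ?_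
  rw [mul_pow, ennreal_rpow_half_sq]
  refine (h σ hσ ![φ₁, φ₂, φ₃, φ₄]).trans_eq ?_
  simp [Fin.prod_univ_four, mul_pow]
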